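/- arXiv:1405.6043 — 3 statements merged into one kernel-verified Lean document; each statement's English description precedes it below -/
import Mathlib

section
/- A hypergraph is β-acyclic (i.e., admits a β-elimination order) if and only if its incidence graph is chordal bipartite (bipartite with every cycle of length at least 6 having a chord). -/
open Finset
open scoped Classical

variable {V : Type*} [Fintype V] [DecidableEq V]

/-- Remove the vertex `x` from a hypergraph (a set of edges), discarding
edges that become empty. -/
def removeV (x : V) (E : Finset (Finset V)) : Finset (Finset V) :=
  (E.image (fun e => e.erase x)).erase ∅

/-- `x` is a nest point: the edges containing `x` form a chain under inclusion. -/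
def IsNest (x : V) (E : Finset (Finset V)) : Prop :=
  ∀ e ∈ E, ∀ f ∈ E, x ∈ e → x ∈ f → e ⊆ f ∨ f ⊆ e

/-- `l` is a sequence of successive nest points of the hypergraph `E`. -/
def ElimList : List V → Finset (Finset V) → Prop
  | [], _ => True
  | x :: xs, E => IsNest x E ∧ ElimList xs (removeV x E)

/-- A hypergraph is β-acyclic iff some enumeration of all its vertices is a
β-elimination order. -/
def BetaAcyclic (E : Finset (Finset V)) : Prop :=
  ∃ l : List V, l.Nodup ∧ (∀ v : V, v ∈ l) ∧ ElimList l E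

/-- The incidence graph of a hypergraph: vertices `V ⊕ E`, with `v` adjacent
to `e` iff `v ∈ e`. -/
def incG (E : Finset (Finset V)) : SimpleGraph (V ⊕ {e // e ∈ E}) :=
  SimpleGraph.fromRel (fun a b =>
    match a, b with
    | Sum.inl v, Sum.inr e => v ∈ e.1
    | _, _ => False)

/-- Every cycle of length at least `6` has a chord: an edge of the graph
between two vertices of the cycle that is not an edge of the cycle. -/
def ChordCond {α : Type*} (G : SimpleGraph α) : Prop :=
  ∀ (v : α) (c : G.Walk v v), c.IsCycle → 6 ≤ c.length →
    ∃ a b, G.Adj a b ∧ a ∈ c.support ∧ b ∈ c.support ∧ s(a, b) ∉ c.edges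

/-- `x` is a nest point of the trace of `E` on `S`. -/
def NestIn {V : Type*} [DecidableEq V] (E : Finset (Finset V)) (S : Finset V) (x : V) : Prop :=
  ∀ e ∈ E, ∀ f ∈ E, x ∈ e → x ∈ f → e ∩ S ⊆ f ∨ f ∩ S ⊆ e

theorem elim_of_nests {V : Type*} [DecidableEq V] (E : Finset (Finset V))
    (h : ∀ S : Finset V, S.Nonempty → ∃ x ∈ S, NestIn E S x) :
    ∀ (n : ℕ) (S : Finset V) (E' : Finset (Finset V)), S.card = n →
      (∀ e' ∈ E', ∃ e ∈ E, e' = e ∩ S) →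
      ∃ l : List V, l.Nodup ∧ (∀ v, v ∈ l ↔ v ∈ S) ∧ ElimList l E' := by
  intro n
  induction n with
  | zero =>
    intro S E' hS _
    rw [Finset.card_eq_zero] at hS
    subst hS
    exact ⟨[], by simp, by simp, trivial⟩
  | succ n ih =>
    intro S E' hS hE'
    obtain ⟨x, hxS, hx⟩ := h S (Finset.card_pos.mp (by omega))
    obtain ⟨l, hl1, hl2, hl3⟩ := ih (S.erase x) (removeV x E')
      (by rw [Finset.card_erase_of_mem hxS]; omega) (by
        intro e' he'
        simp only [removeV, Finset.mem_erase, Finset.mem_image] at he'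
        obtain ⟨_, a, ha, rfl⟩ := he'
        obtain ⟨e, he, rfl⟩ := hE' a ha
        refine ⟨e, he, ?_⟩
        ext v
        simp only [Finset.mem_erase, Finset.mem_inter]
        tauto)
    refine ⟨x :: l, ?_, ?_, ?_, hl3⟩
    · simp [hl1, hl2]
    · intro v
      simp only [List.mem_cons, hl2, Finset.mem_erase]
      by_cases hv : v = x
      · subst hv; simp [hxS]
      · simp [hv]
    · intro e he f hf hxe hxf
      obtain ⟨e1, he1, rfl⟩ := hE' e he
      obtain ⟨f1, hf1, rfl⟩ := hE' f hf
      simp only [Finset.mem_inter] at hxe hxf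
      rcases hx e1 he1 f1 hf1 hxe.1 hxf.1 with h | h
      · left; exact Finset.subset_inter h Finset.inter_subset_right
      · right; exact Finset.subset_inter h Finset.inter_subset_right

theorem no_elim_of_obstruct {V : Type*} [DecidableEq V] (S : Finset V) (hS : S.Nonempty) :
    ∀ (l : List V) (E : Finset (Finset V)), (∀ v ∈ S, v ∈ l) →
      (∀ x ∈ S, ∃ e ∈ E, ∃ f ∈ E, x ∈ e ∧ x ∈ f ∧
        (∃ y ∈ S, y ∈ e ∧ y ∉ f) ∧ (∃ z ∈ S, z ∈ f ∧ z ∉ e)) →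
      ElimList l E → False := by
  intro l
  induction l with
  | nil =>
    intro E hl _ _
    obtain ⟨v, hv⟩ := hS
    simpa using hl v hv
  | cons x l ih =>
    intro E hl hob hel
    obtain ⟨hn, hel⟩ := hel
    by_cases hx : x ∈ S
    · obtain ⟨e, he, f, hf, hxe, hxf, ⟨y, _, hy1, hy2⟩, z, _, hz1, hz2⟩ := hob x hx
      rcases hn e he f hf hxe hxf with h | h
      · exact hy2 (h hy1)
      · exact hz2 (h hz1)
    · have hne : ∀ v ∈ S, v ≠ x := fun v hv hvx => hx (hvx ▸ hv)
      refine ih (removeV x E) ?_ ?_ hel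
      · intro v hv
        have := hl v hv
        simp only [List.mem_cons] at this
        exact this.resolve_left (hne v hv)
      · intro w hw
        obtain ⟨e, he, f, hf, hxe, hxf, ⟨y, hy, hy1, hy2⟩, z, hz, hz1, hz2⟩ := hob w hw
        have key : ∀ g ∈ E, w ∈ g → g.erase x ∈ removeV x E := by
          intro g hg hwg
          simp only [removeV, Finset.mem_erase, Finset.mem_image]
          refine ⟨?_, g, hg, rfl⟩
          exact Finset.ne_empty_of_mem (Finset.mem_erase.mpr ⟨hne w hw, hwg⟩)
        refine ⟨_, key e he hxe, _, key f hf hxf, ?_, ?_, ⟨y, hy, ?_, ?_⟩, z, hz, ?_, ?_⟩ <;>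
          simp [hne w hw, hne y hy, hne z hz, *]

theorem incG_adj_lr {V : Type*} [DecidableEq V] (E : Finset (Finset V)) (v : V)
    (e : {e // e ∈ E}) : (incG E).Adj (Sum.inl v) (Sum.inr e) ↔ v ∈ e.1 := by
  simp [incG, SimpleGraph.fromRel_adj]

theorem incG_adj_rl {V : Type*} [DecidableEq V] (E : Finset (Finset V)) (v : V)
    (e : {e // e ∈ E}) : (incG E).Adj (Sum.inr e) (Sum.inl v) ↔ v ∈ e.1 := by
  simp [incG, SimpleGraph.fromRel_adj]

theorem incG_adj_ll {V : Type*} [DecidableEq V] (E : Finset (Finset V)) (v w : V) :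
    ¬ (incG E).Adj (Sum.inl v) (Sum.inl w) := by
  simp [incG, SimpleGraph.fromRel_adj]

theorem incG_adj_rr {V : Type*} [DecidableEq V] (E : Finset (Finset V))
    (e f : {e // e ∈ E}) : ¬ (incG E).Adj (Sum.inr e) (Sum.inr f) := by
  simp [incG, SimpleGraph.fromRel_adj]

theorem incG_colorable {V : Type*} [DecidableEq V] (E : Finset (Finset V)) :
    (incG E).Colorable 2 := by
  refine ⟨SimpleGraph.Coloring.mk (fun a => Sum.elim (fun _ => (0 : Fin 2)) (fun _ => 1) a) ?_⟩
  rintro (v | e) (w | f) h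
  · exact absurd h (incG_adj_ll E v w)
  · simp
  · simp
  · exact absurd h (incG_adj_rr E e f)

/-- A walk along a function. -/
theorem walk_of_fun {α : Type*} (G : SimpleGraph α) (f : ℕ → α) :
    ∀ n : ℕ, (∀ i < n, G.Adj (f i) (f (i + 1))) →
      ∃ p : G.Walk (f 0) (f n), p.length = n ∧
        p.support = (List.range (n + 1)).map f ∧
        (∀ i < n, s(f i, f (i + 1)) ∈ p.edges) ∧
        (∀ z ∈ p.edges, ∃ i < n, z = s(f i, f (i + 1))) := by
  intro n
  induction n with
  | zero => intro _; exact ⟨SimpleGraph.Walk.nil, by simp⟩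
  | succ n ih =>
    intro h
    obtain ⟨p, h1, h2, h3, h4⟩ := ih (fun i hi => h i (by omega))
    refine ⟨p.concat (h n (by omega)), ?_, ?_, ?_, ?_⟩
    · simp [h1]
    · rw [SimpleGraph.Walk.support_concat, h2, List.range_succ (n := n + 1)]
      simp
    · intro i hi
      rw [SimpleGraph.Walk.edges_concat]
      rcases Nat.lt_succ_iff_lt_or_eq.mp hi with h | rfl
      · simp [h3 i h]
      · simp
    · intro z hz
      rw [SimpleGraph.Walk.edges_concat] at hz
      simp only [List.concat_eq_append, List.mem_append, List.mem_singleton] at hz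
      rcases hz with hz | rfl
      · obtain ⟨i, hi, rfl⟩ := h4 z hz
        exact ⟨i, by omega, rfl⟩
      · exact ⟨n, by omega, rfl⟩

theorem no_induced {α : Type*} (G : SimpleGraph α) (hG : ChordCond G) (f : ℕ → α) (n : ℕ)
    (hn : 5 ≤ n) (hinj : ∀ i ≤ n, ∀ j ≤ n, f i = f j → i = j)
    (hadj : ∀ i < n, G.Adj (f i) (f (i + 1))) (hlast : G.Adj (f n) (f 0))
    (hch : ∀ i j, i < j → j ≤ n → G.Adj (f i) (f j) → j = i + 1 ∨ (i = 0 ∧ j = n)) : False := by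
  obtain ⟨p, h1, h2, h3, h4⟩ := walk_of_fun G f n hadj
  have hp : p.IsPath := by
    rw [SimpleGraph.Walk.isPath_def, h2]
    refine List.Nodup.map_on ?_ List.nodup_range
    intro x hx y hy hxy
    simp only [List.mem_range] at hx hy
    exact hinj x (by omega) y (by omega) hxy
  have hc : (SimpleGraph.Walk.cons hlast p).IsCycle := by
    rw [SimpleGraph.Walk.cons_isCycle_iff]
    refine ⟨hp, ?_⟩
    intro hmem
    obtain ⟨i, hi, he⟩ := h4 _ hmem
    rw [Sym2.eq_iff] at he
    rcases he with ⟨a, b⟩ | ⟨a, b⟩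
    · have := hinj _ le_rfl _ (by omega) a; omega
    · have := hinj _ le_rfl _ (by omega) a
      have := hinj _ (by omega) _ (by omega) b
      omega
  obtain ⟨a, b, hab, ha, hb, hne⟩ := hG _ _ hc (by simp [h1]; omega)
  have hsup : ∀ a ∈ (SimpleGraph.Walk.cons hlast p).support, ∃ i ≤ n, a = f i := by
    intro a ha
    rw [SimpleGraph.Walk.support_cons, h2] at ha
    simp only [List.mem_cons, List.mem_map, List.mem_range] at ha
    rcases ha with rfl | ⟨i, hi, rfl⟩
    · exact ⟨n, le_rfl, rfl⟩
    · exact ⟨i, by omega, rfl⟩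
  have main : ∀ i j, i < j → j ≤ n → G.Adj (f i) (f j) →
      s(f i, f j) ∈ (SimpleGraph.Walk.cons hlast p).edges := by
    intro i j hij hj hadj'
    rw [SimpleGraph.Walk.edges_cons]
    rcases hch i j hij hj hadj' with rfl | ⟨rfl, rfl⟩
    · exact List.mem_cons_of_mem _ (h3 i (by omega))
    · rw [Sym2.eq_swap]; simp
  obtain ⟨i, hi, rfl⟩ := hsup a ha
  obtain ⟨j, hj, rfl⟩ := hsup b hb
  rcases lt_trichotomy i j with h | rfl | h
  · exact hne (main i j h hj hab)
  · exact G.loopless.irrefl _ hab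
  · exact hne (Sym2.eq_swap ▸ main j i h hi hab.symm)

/-- A chordless cyclic sequence of vertices and edges is impossible. -/
theorem no_hyper_induced {V : Type*} [DecidableEq V] (E : Finset (Finset V))
    (hG : ChordCond (incG E)) (u : ℕ → V) (g : ℕ → Finset V) (N : ℕ) (hN : 2 ≤ N)
    (hgE : ∀ i ≤ N, g i ∈ E)
    (h : ∀ i ≤ N, ∀ j ≤ N, (u i ∈ g j ↔ (j = i ∨ j + 1 = i ∨ (i = 0 ∧ j = N)))) : False := by
  have huinj : ∀ i ≤ N, ∀ j ≤ N, u i = u j → i = j := by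
    intro i hi j hj hij
    have h1 := h i hi i hi
    have h2 := h i hi j hj
    have h3 := h j hj i hi
    have h4 := h j hj j hj
    rw [hij] at h1 h2
    have a1 := h3.mp (h1.mpr (Or.inl rfl))
    have a2 := h2.mp (h4.mpr (Or.inl rfl))
    omega
  have hginj : ∀ i ≤ N, ∀ j ≤ N, g i = g j → i = j := by
    intro i hi j hj hij
    have h1 := h i hi i hi
    have h2 := h i hi j hj
    have h3 := h j hj i hi
    have h4 := h j hj j hj
    rw [hij] at h1 h3
    have a1 := h2.mp (h1.mpr (Or.inl rfl))
    have a2 := h3.mp (h4.mpr (Or.inl rfl))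
    omega
  let G' : ℕ → {e // e ∈ E} := fun i => if hi : i ≤ N then ⟨g i, hgE i hi⟩ else ⟨g 0, hgE 0 (by omega)⟩
  have hG' : ∀ i ≤ N, (G' i).1 = g i := by
    intro i hi; simp [G', hi]
  let f : ℕ → V ⊕ {e // e ∈ E} := fun i => if i % 2 = 0 then Sum.inl (u (i / 2)) else Sum.inr (G' (i / 2))
  have f0 : ∀ i, i % 2 = 0 → f i = Sum.inl (u (i / 2)) := fun i hi => by simp [f, hi]
  have f1 : ∀ i, i % 2 = 1 → f i = Sum.inr (G' (i / 2)) := fun i hi => by simp [f, hi]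
  have par : ∀ i : ℕ, i % 2 = 0 ∨ i % 2 = 1 := fun i => by omega
  refine no_induced (incG E) hG f (2 * N + 1) (by omega) ?_ ?_ ?_ ?_
  · intro i hi j hj hij
    rcases par i with pi | pi <;> rcases par j with pj | pj
    · rw [f0 i pi, f0 j pj] at hij
      have := huinj _ (by omega) _ (by omega) (Sum.inl.inj hij)
      omega
    · rw [f0 i pi, f1 j pj] at hij; cases hij
    · rw [f1 i pi, f0 j pj] at hij; cases hij
    · rw [f1 i pi, f1 j pj] at hij
      have h2 := congrArg Subtype.val (Sum.inr.inj hij)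
      rw [hG' _ (by omega), hG' _ (by omega)] at h2
      have := hginj _ (by omega) _ (by omega) h2
      omega
  · intro i hi
    rcases par i with pi | pi
    · rw [f0 i pi, f1 (i + 1) (by omega), incG_adj_lr, hG' _ (by omega), h _ (by omega) _ (by omega)]
      omega
    · rw [f1 i pi, f0 (i + 1) (by omega), incG_adj_rl, hG' _ (by omega), h _ (by omega) _ (by omega)]
      omega
  · rw [f1 (2 * N + 1) (by omega), f0 0 (by omega), incG_adj_rl, hG' _ (by omega),
      h _ (by omega) _ (by omega)]
    omega
  · intro i j hij hj hadj
    rcases par i with pi | pi <;> rcases par j with pj | pj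
    · rw [f0 i pi, f0 j pj] at hadj
      exact absurd hadj (incG_adj_ll _ _ _)
    · rw [f0 i pi, f1 j pj, incG_adj_lr, hG' _ (by omega), h _ (by omega) _ (by omega)] at hadj
      omega
    · rw [f1 i pi, f0 j pj, incG_adj_rl, hG' _ (by omega), h _ (by omega) _ (by omega)] at hadj
      omega
    · rw [f1 i pi, f1 j pj] at hadj
      exact absurd hadj (incG_adj_rr _ _ _)

/-- A cyclic sequence whose only possible chords avoid `u 0`, `u N` and `g N` is impossible. -/
theorem no_semi_induced {V : Type*} [DecidableEq V] (E : Finset (Finset V))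
    (hG : ChordCond (incG E)) : ∀ (N : ℕ) (u : ℕ → V) (g : ℕ → Finset V), 2 ≤ N →
    (∀ i ≤ N, g i ∈ E) → (∀ i ≤ N, u i ∈ g i) → (∀ i < N, u (i + 1) ∈ g i) → u 0 ∈ g N →
    (∀ i, 0 < i → i < N → u i ∉ g N) → (∀ j, 0 < j → j < N → u 0 ∉ g j) →
    (∀ j, j + 1 < N → u N ∉ g j) → False := by
  intro N
  induction N using Nat.strong_induction_on with
  | _ N ih =>
    intro u g hN hgE h1 h2 h3 h4 h5 h6
    by_cases hch : ∃ i j, 0 < i ∧ i < N ∧ j < N ∧ j ≠ i ∧ j + 1 ≠ i ∧ u i ∈ g j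
    · obtain ⟨i, j, hi0, hiN, hjN, hji, hji1, hm⟩ := hch
      rcases lt_or_gt_of_ne hji with hlt | hgt
      · -- `j + 1 < i`
        have hd : N - (i - j - 1) + (i - j - 1) = N := by omega
        have e1 : ∀ t, t ≤ j → (if t ≤ j then u t else u (t + (i - j - 1))) = u t :=
          fun t ht => by simp [ht]
        have e2 : ∀ t, ¬ t ≤ j → (if t ≤ j then u t else u (t + (i - j - 1))) = u (t + (i - j - 1)) :=
          fun t ht => by simp [ht]
        have e3 : ∀ t, t ≤ j → (if t ≤ j then g t else g (t + (i - j - 1))) = g t :=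
          fun t ht => by simp [ht]
        have e4 : ∀ t, ¬ t ≤ j → (if t ≤ j then g t else g (t + (i - j - 1))) = g (t + (i - j - 1)) :=
          fun t ht => by simp [ht]
        refine ih (N - (i - j - 1)) (by omega)
          (fun t => if t ≤ j then u t else u (t + (i - j - 1)))
          (fun t => if t ≤ j then g t else g (t + (i - j - 1))) (by omega) ?_ ?_ ?_ ?_ ?_ ?_ ?_
        · intro t ht
          by_cases c : t ≤ j
          · simp only [e3 t c]; exact hgE t (by omega)
          · simp only [e4 t c]; exact hgE _ (by omega)
        · intro t ht
          by_cases c : t ≤ j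
          · simp only [e3 t c, e1 t c]; exact h1 t (by omega)
          · simp only [e4 t c, e2 t c]; exact h1 _ (by omega)
        · intro t ht
          by_cases c : t ≤ j
          · by_cases c' : t + 1 ≤ j
            · simp only [e3 t c, e1 (t + 1) c']; exact h2 t (by omega)
            · simp only [e3 t c, e2 (t + 1) c']
              obtain rfl : t = j := by omega
              have : t + 1 + (i - t - 1) = i := by omega
              rw [this]; exact hm
          · simp only [e4 t c, e2 (t + 1) (by omega)]
            have : t + 1 + (i - j - 1) = t + (i - j - 1) + 1 := by omega
            rw [this]; exact h2 _ (by omega)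
        · simp only [e1 0 (by omega), e4 (N - (i - j - 1)) (by omega)]; rw [hd]; exact h3
        · intro t ht0 ht
          simp only [e4 (N - (i - j - 1)) (by omega)]; rw [hd]
          by_cases c : t ≤ j
          · simp only [e1 t c]; exact h4 t ht0 (by omega)
          · simp only [e2 t c]; exact h4 _ (by omega) (by omega)
        · intro t ht0 ht
          simp only [e1 0 (by omega)]
          by_cases c : t ≤ j
          · simp only [e3 t c]; exact h5 t ht0 (by omega)
          · simp only [e4 t c]; exact h5 _ (by omega) (by omega)
        · intro t ht
          simp only [e2 (N - (i - j - 1)) (by omega)]; rw [hd]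
          by_cases c : t ≤ j
          · simp only [e3 t c]; exact h6 t (by omega)
          · simp only [e4 t c]; exact h6 _ (by omega)
      · -- `i < j`
        have hd : N - (j - i) + (j - i) = N := by omega
        have e1 : ∀ t, t ≤ i → (if t ≤ i then u t else u (t + (j - i))) = u t :=
          fun t ht => by simp [ht]
        have e2 : ∀ t, ¬ t ≤ i → (if t ≤ i then u t else u (t + (j - i))) = u (t + (j - i)) :=
          fun t ht => by simp [ht]
        have e3 : ∀ t, t < i → (if t < i then g t else g (t + (j - i))) = g t :=
          fun t ht => by simp [ht]
        have e4 : ∀ t, ¬ t < i → (if t < i then g t else g (t + (j - i))) = g (t + (j - i)) :=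
          fun t ht => by simp [ht]
        refine ih (N - (j - i)) (by omega)
          (fun t => if t ≤ i then u t else u (t + (j - i)))
          (fun t => if t < i then g t else g (t + (j - i))) (by omega) ?_ ?_ ?_ ?_ ?_ ?_ ?_
        · intro t ht
          by_cases c : t < i
          · simp only [e3 t c]; exact hgE t (by omega)
          · simp only [e4 t c]; exact hgE _ (by omega)
        · intro t ht
          by_cases c : t < i
          · simp only [e3 t c, e1 t c.le]; exact h1 t (by omega)
          · by_cases c' : t ≤ i
            · obtain rfl : t = i := by omega
              simp only [e4 t c, e1 t c']
              have : t + (j - t) = j := by omega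
              rw [this]; exact hm
            · simp only [e4 t c, e2 t c']; exact h1 _ (by omega)
        · intro t ht
          by_cases c : t < i
          · simp only [e3 t c, e1 (t + 1) c]; exact h2 t (by omega)
          · simp only [e4 t c, e2 (t + 1) (by omega)]
            have : t + 1 + (j - i) = t + (j - i) + 1 := by omega
            rw [this]; exact h2 _ (by omega)
        · simp only [e1 0 (by omega), e4 (N - (j - i)) (by omega)]; rw [hd]; exact h3
        · intro t ht0 ht
          simp only [e4 (N - (j - i)) (by omega)]; rw [hd]
          by_cases c : t ≤ i
          · simp only [e1 t c]; exact h4 t ht0 (by omega)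
          · simp only [e2 t c]; exact h4 _ (by omega) (by omega)
        · intro t ht0 ht
          simp only [e1 0 (by omega)]
          by_cases c : t < i
          · simp only [e3 t c]; exact h5 t ht0 (by omega)
          · simp only [e4 t c]; exact h5 _ (by omega) (by omega)
        · intro t ht
          simp only [e2 (N - (j - i)) (by omega)]; rw [hd]
          by_cases c : t < i
          · simp only [e3 t c]; exact h6 t (by omega)
          · simp only [e4 t c]; exact h6 _ (by omega)
    · push Not at hch
      refine no_hyper_induced E hG u g N hN hgE ?_
      intro i hi j hj
      constructor
      · intro hm
        by_contra hcon
        rcases Nat.eq_zero_or_pos i with rfl | hi0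
        · exact h5 j (by omega) (by omega) hm
        · rcases hj.lt_or_eq with hjN | rfl
          · rcases hi.lt_or_eq with hiN | rfl
            · exact hch i j hi0 hiN hjN (by omega) (by omega) hm
            · exact h6 j (by omega) hm
          · exact h4 i hi0 (by omega) hm
      · rintro (rfl | rfl | ⟨rfl, rfl⟩)
        · exact h1 _ hi
        · exact h2 _ (by omega)
        · exact h3

theorem fun_of_rtg {α : Type*} (R : α → α → Prop) (a b : α) (h : Relation.ReflTransGen R a b) :
    ∃ (q : ℕ → α) (m : ℕ), q 0 = a ∧ q m = b ∧ ∀ i < m, R (q i) (q (i + 1)) := by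
  induction h with
  | refl => exact ⟨fun _ => a, 0, rfl, rfl, by simp⟩
  | @tail b c _ hbc ih =>
    obtain ⟨q, m, h0, hm, hq⟩ := ih
    refine ⟨fun i => if i ≤ m then q i else c, m + 1, by simp [h0], by simp, ?_⟩
    intro i hi
    rcases Nat.lt_succ_iff_lt_or_eq.mp hi with h | rfl
    · have h' : i + 1 ≤ m := h
      simp only [h.le, h', if_true]; exact hq i h
    · simp [hm, hbc]

/-- The relation linking two non-full edges sharing a vertex of `S` outside `e0`. -/
def Link {V : Type*} (E : Finset (Finset V)) (S e0 e f : Finset V) : Prop :=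
  e ∈ E ∧ f ∈ E ∧ ¬ S ⊆ e ∧ ¬ S ⊆ f ∧ ∃ x ∈ S, x ∉ e0 ∧ x ∈ e ∧ x ∈ f

theorem Link.symm' {V : Type*} {E : Finset (Finset V)} {S e0 e f : Finset V}
    (h : Link E S e0 e f) : Link E S e0 f e := by
  obtain ⟨h1, h2, h3, h4, x, h5, h6, h7, h8⟩ := h
  exact ⟨h2, h1, h4, h3, x, h5, h6, h8, h7⟩

/-- From a linked sequence with suitable `a`, `b` we get a contradiction. -/
theorem no_link_path {V : Type*} [DecidableEq V] (E : Finset (Finset V))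
    (hG : ChordCond (incG E)) (S e0 : Finset V) (he0 : e0 ∈ E) (q : ℕ → Finset V) (m : ℕ)
    (hq : ∀ i < m, Link E S e0 (q i) (q (i + 1))) (hm : 1 ≤ m) (a b : V) (ha : a ∈ e0)
    (hb : b ∈ e0) (ha0 : a ∈ q 0) (hbm : b ∈ q m) (ha' : ∀ i, 0 < i → i ≤ m → a ∉ q i)
    (hb' : ∀ i < m, b ∉ q i) : False := by
  have hqE : ∀ i ≤ m, q i ∈ E := by
    intro i hi
    rcases hi.lt_or_eq with h | rfl
    · exact (hq i h).1
    · have := (hq (i - 1) (by omega)).2.1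
      rwa [show i - 1 + 1 = i by omega] at this
  have hx : ∀ i, ∃ x, i < m → x ∉ e0 ∧ x ∈ q i ∧ x ∈ q (i + 1) := by
    intro i
    by_cases hi : i < m
    · obtain ⟨_, _, _, _, x, _, h⟩ := hq i hi
      exact ⟨x, fun _ => h⟩
    · exact ⟨a, fun h => absurd h hi⟩
  choose x hx using hx
  let u : ℕ → V := fun i => if i = 0 then a else if i = m + 1 then b else x (i - 1)
  let g : ℕ → Finset V := fun i => if i = m + 1 then e0 else q i
  have u0 : u 0 = a := by simp [u]
  have uN : u (m + 1) = b := by simp [u]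
  have ui : ∀ i < m, u (i + 1) = x i := by
    intro i hi
    have : i ≠ m := by omega
    simp [u, this]
  have gN : g (m + 1) = e0 := by simp [g]
  have gi : ∀ i ≤ m, g i = q i := by
    intro i hi
    have : i ≠ m + 1 := by omega
    simp [g, this]
  refine no_semi_induced E hG (m + 1) u g (by omega) ?_ ?_ ?_ ?_ ?_ ?_ ?_
  · intro i hi
    rcases hi.lt_or_eq with h | rfl
    · rw [gi i (by omega)]; exact hqE i (by omega)
    · rw [gN]; exact he0
  · intro i hi
    rcases hi.lt_or_eq with h | rfl
    · rw [gi i (by omega)]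
      rcases i with _ | i
      · rw [u0]; exact ha0
      · rw [ui i (by omega)]; exact (hx i (by omega)).2.2
    · rw [gN, uN]; exact hb
  · intro i hi
    rw [gi i (by omega)]
    rcases (Nat.lt_succ_iff.mp hi).lt_or_eq with h | rfl
    · rw [ui i h]; exact (hx i h).2.1
    · rw [uN]; exact hbm
  · rw [u0, gN]; exact ha
  · intro i h0 hi
    obtain ⟨i, rfl⟩ : ∃ k, i = k + 1 := ⟨i - 1, by omega⟩
    rw [gN, ui i (by omega)]; exact (hx i (by omega)).1
  · intro j h0 hj
    rw [u0, gi j (by omega)]; exact ha' j h0 (by omega)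
  · intro j hj
    rw [uN, gi j (by omega)]; exact hb' j (by omega)

theorem exists_dominating {V : Type*} [DecidableEq V] (E : Finset (Finset V))
    (hG : ChordCond (incG E)) (S e0 : Finset V) (he0 : e0 ∈ E) (B : Finset V) (hB : B ⊆ e0)
    (C : Finset (Finset V)) (hC : C.Nonempty)
    (hconn : ∀ e ∈ C, ∀ f ∈ C, Relation.ReflTransGen (Link E S e0) e f)
    (hcl : ∀ e ∈ C, ∀ f, Link E S e0 e f → f ∈ C)
    (hcov : ∀ b ∈ B, ∃ e ∈ C, b ∈ e) : ∃ y ∈ C, B ⊆ y := by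
  obtain ⟨y, hy, hmax⟩ := Finset.exists_max_image C (fun e => (e ∩ B).card) hC
  refine ⟨y, hy, ?_⟩
  by_contra hnot
  obtain ⟨b, hbB, hby⟩ := Finset.not_subset.mp hnot
  obtain ⟨y', hy', hby'⟩ := hcov b hbB
  obtain ⟨q, m0, hq0, hqm0, hq⟩ := fun_of_rtg _ _ _ (hconn y hy y' hy')
  have hex : ∃ m, b ∈ q m := ⟨m0, by rw [hqm0]; exact hby'⟩
  obtain ⟨m, hm, hmin⟩ : ∃ m, b ∈ q m ∧ ∀ k < m, b ∉ q k :=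
    ⟨Nat.find hex, Nat.find_spec hex, fun k hk => Nat.find_min hex hk⟩
  have hmm0 : m ≤ m0 := by
    by_contra hlt
    exact hmin m0 (by omega) (by rw [hqm0]; exact hby')
  have hqC : ∀ i ≤ m, q i ∈ C := by
    intro i
    induction i with
    | zero => intro _; rw [hq0]; exact hy
    | succ i ih => intro hi; exact hcl _ (ih (by omega)) _ (hq i (by omega))
  have hane : ∃ a ∈ y ∩ B, a ∉ q m := by
    by_contra hcon
    push Not at hcon
    have hsub : y ∩ B ⊂ q m ∩ B := by
      refine (Finset.ssubset_iff_of_subset ?_).mpr ⟨b, by simp [hm, hbB], by simp [hby]⟩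
      intro v hv
      exact Finset.mem_inter.mpr ⟨hcon v hv, (Finset.mem_inter.mp hv).2⟩
    have := Finset.card_lt_card hsub
    have := hmax (q m) (hqC m le_rfl)
    omega
  obtain ⟨a, ha, ham⟩ := hane
  simp only [Finset.mem_inter] at ha
  -- last index with `a ∈ q i`
  have hex2 : ∃ k, k ≤ m ∧ a ∈ q (m - k) := ⟨m, le_rfl, by simp [hq0, ha.1]⟩
  obtain ⟨k, ⟨hkm, hak⟩, hkmin⟩ : ∃ k, (k ≤ m ∧ a ∈ q (m - k)) ∧
      ∀ k' < k, ¬ (k' ≤ m ∧ a ∈ q (m - k')) :=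
    ⟨Nat.find hex2, Nat.find_spec hex2, fun k hk => Nat.find_min hex2 hk⟩
  have hk0 : k ≠ 0 := by
    rintro rfl
    exact ham (by simpa using hak)
  refine no_link_path E hG S e0 he0 (fun i => q (m - k + i)) k ?_ (by omega) a b (hB ha.2)
    (hB hbB) (by simpa using hak) ?_ ?_ ?_
  · intro i hi
    exact hq (m - k + i) (by omega)
  · show b ∈ q (m - k + k)
    rw [Nat.sub_add_cancel hkm]; exact hm
  · intro i hi hik hmem
    refine hkmin (k - i) (by omega) ⟨by omega, ?_⟩
    rwa [show m - (k - i) = m - k + i by omega]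
  · intro i hi
    exact hmin _ (by omega)

theorem exists_nest_outside {V : Type*} [DecidableEq V] (E : Finset (Finset V))
    (hG : ChordCond (incG E)) : ∀ (n : ℕ) (S e0 : Finset V), S.card + (S \ e0).card = n →
      e0 ∈ E → ¬ S ⊆ e0 → ∃ x ∈ S, x ∉ e0 ∧ NestIn E S x := by
  intro n
  induction n using Nat.strong_induction_on with
  | _ n ih =>
    intro S e0 hn he0 hS
    obtain ⟨x0, hx0S, hx0e⟩ := Finset.not_subset.mp hS
    by_cases hfull : ∀ e ∈ E, x0 ∈ e → S ⊆ e
    · refine ⟨x0, hx0S, hx0e, ?_⟩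
      intro e he f hf hxe hxf
      exact Or.inl (Finset.inter_subset_right.trans (hfull f hf hxf))
    push Not at hfull
    obtain ⟨e1, he1, hxe1, hSe1⟩ := hfull
    let C : Finset (Finset V) := E.filter (fun f => Relation.ReflTransGen (Link E S e0) e1 f)
    have hCm : ∀ f, f ∈ C ↔ f ∈ E ∧ Relation.ReflTransGen (Link E S e0) e1 f := by
      intro f; simp [C]
    have he1C : e1 ∈ C := (hCm e1).mpr ⟨he1, Relation.ReflTransGen.refl⟩
    have hsymm : ∀ e f, Relation.ReflTransGen (Link E S e0) e f →
        Relation.ReflTransGen (Link E S e0) f e := by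
      intro e f h
      induction h with
      | refl => exact Relation.ReflTransGen.refl
      | tail _ h2 ih => exact Relation.ReflTransGen.head h2.symm' ih
    have hconn : ∀ e ∈ C, ∀ f ∈ C, Relation.ReflTransGen (Link E S e0) e f := fun e he f hf =>
      (hsymm _ _ ((hCm e).mp he).2).trans ((hCm f).mp hf).2
    have hcl : ∀ e ∈ C, ∀ f, Link E S e0 e f → f ∈ C := fun e he f hl =>
      (hCm f).mpr ⟨hl.2.1, ((hCm e).mp he).2.tail hl⟩
    have htouch : ∀ f ∈ C, ¬ S ⊆ f ∧ ∃ x ∈ S, x ∉ e0 ∧ x ∈ f := by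
      intro f hf
      rcases ((hCm f).mp hf).2.cases_tail with h | ⟨c, _, hl⟩
      · subst h
        exact ⟨hSe1, x0, hx0S, hx0e, hxe1⟩
      · obtain ⟨_, _, _, h, x, hxS, hx0, _, hx⟩ := hl
        exact ⟨h, x, hxS, hx0, hx⟩
    let S' : Finset V := S.filter (fun x => ∃ f ∈ C, x ∈ f)
    have hS'm : ∀ x, x ∈ S' ↔ x ∈ S ∧ ∃ f ∈ C, x ∈ f := by
      intro x; simp only [S', Finset.mem_filter]
    have hS'S : S' ⊆ S := Finset.filter_subset _ _
    have hx0S' : x0 ∈ S' := (hS'm x0).mpr ⟨hx0S, e1, he1C, hxe1⟩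
    by_cases hSS : S' = S
    · obtain ⟨y, hyC, hBy⟩ := exists_dominating E hG S e0 he0 (S ∩ e0) Finset.inter_subset_right C
        ⟨e1, he1C⟩ hconn hcl (by
          intro b hb
          have : b ∈ S' := by rw [hSS]; exact (Finset.mem_inter.mp hb).1
          exact ((hS'm b).mp this).2)
      obtain ⟨hyS, w, hwS, hwe0, hwy⟩ := htouch y hyC
      have hlt : (S \ y).card < (S \ e0).card := by
        apply Finset.card_lt_card
        refine (Finset.ssubset_iff_of_subset ?_).mpr ⟨w, by simp [hwS, hwe0], by simp [hwy]⟩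
        intro v hv
        simp only [Finset.mem_sdiff] at hv ⊢
        exact ⟨hv.1, fun h => hv.2 (hBy (Finset.mem_inter.mpr ⟨hv.1, h⟩))⟩
      obtain ⟨x, hxS, hxy, hx⟩ := ih (S.card + (S \ y).card) (by omega) S y rfl
        ((hCm y).mp hyC).1 hyS
      exact ⟨x, hxS, fun h => hxy (hBy (Finset.mem_inter.mpr ⟨hxS, h⟩)), hx⟩
    · have hss : S' ⊂ S := lt_of_le_of_ne hS'S hSS
      have c1 := Finset.card_lt_card hss
      have c2 : (S' \ e0).card ≤ (S \ e0).card :=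
        Finset.card_le_card (Finset.sdiff_subset_sdiff hS'S le_rfl)
      obtain ⟨x, hxS', hxe0, hx⟩ := ih (S'.card + (S' \ e0).card) (by omega) S' e0 rfl he0
        (fun h => hx0e (h hx0S'))
      refine ⟨x, hS'S hxS', hxe0, ?_⟩
      intro e he f hf hxe hxf
      by_cases hSf : S ⊆ f
      · exact Or.inl (Finset.inter_subset_right.trans hSf)
      by_cases hSe : S ⊆ e
      · exact Or.inr (Finset.inter_subset_right.trans hSe)
      obtain ⟨hxS, c, hcC, hxc⟩ := (hS'm x).mp hxS'
      have inC : ∀ g ∈ E, x ∈ g → ¬ S ⊆ g → g ∈ C := fun g hg hxg hSg =>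
        hcl c hcC g ⟨((hCm c).mp hcC).1, hg, (htouch c hcC).1, hSg, x, hxS, hxe0, hxc, hxg⟩
      have sub : ∀ g ∈ C, g ∩ S ⊆ g ∩ S' := by
        intro g hg v hv
        simp only [Finset.mem_inter] at hv
        exact Finset.mem_inter.mpr ⟨hv.1, (hS'm v).mpr ⟨hv.2, g, hg, hv.1⟩⟩
      rcases hx e he f hf hxe hxf with h | h
      · exact Or.inl ((sub e (inC e he hxe hSe)).trans h)
      · exact Or.inr ((sub f (inC f hf hxf hSf)).trans h)

theorem exists_nest {V : Type*} [DecidableEq V] (E : Finset (Finset V))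
    (hG : ChordCond (incG E)) (S : Finset V) (hS : S.Nonempty) : ∃ x ∈ S, NestIn E S x := by
  by_cases h : ∀ e ∈ E, S ⊆ e
  · obtain ⟨x, hx⟩ := hS
    exact ⟨x, hx, fun e _ f hf _ _ => Or.inl (Finset.inter_subset_right.trans (h f hf))⟩
  · push Not at h
    obtain ⟨e0, he0, hS0⟩ := h
    obtain ⟨x, hx, _, hn⟩ := exists_nest_outside E hG _ S e0 rfl he0 hS0
    exact ⟨x, hx, hn⟩

theorem obstruct_of_cycle {V : Type*} [DecidableEq V] (E : Finset (Finset V)) (x : V)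
    (c : (incG E).Walk (Sum.inl x) (Sum.inl x)) (hc : c.IsCycle) (hlen : 6 ≤ c.length)
    (hno : ∀ a b, (incG E).Adj a b → a ∈ c.support → b ∈ c.support → s(a, b) ∈ c.edges) :
    ∃ e ∈ E, ∃ f ∈ E, x ∈ e ∧ x ∈ f ∧
        (∃ y, Sum.inl y ∈ c.support ∧ y ∈ e ∧ y ∉ f) ∧
        (∃ z, Sum.inl z ∈ c.support ∧ z ∈ f ∧ z ∉ e) := by
  have hinj : ∀ i, i < c.length → ∀ j, j < c.length → c.getVert i = c.getVert j → i = j := by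
    intro i hi j hj hij
    exact hc.getVert_injOn' (by simp only [Set.mem_ofPred_eq]; omega)
      (by simp only [Set.mem_ofPred_eq]; omega) hij
  have hsup : ∀ i, c.getVert i ∈ c.support := fun i => c.getVert_mem_support i
  have hnadj : ∀ i j, i + 1 < j → j < c.length → 0 < i →
      ¬ (incG E).Adj (c.getVert i) (c.getVert j) := by
    intro i j hij hj hi hadj
    have hmem := hno _ _ hadj (hsup i) (hsup j)
    obtain ⟨k, hk, hke⟩ := List.getElem_of_mem hmem
    rw [SimpleGraph.Walk.getElem_edges] at hke
    rw [SimpleGraph.Walk.length_edges] at hk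
    have hwrap : k + 1 = c.length → c.getVert (k + 1) = c.getVert 0 := by
      intro h; rw [h, c.getVert_length, c.getVert_zero]
    rw [Sym2.eq_iff] at hke
    by_cases hkl : k + 1 < c.length
    · rcases hke with ⟨h1, h2⟩ | ⟨h1, h2⟩
      · have := hinj _ hk _ (by omega) h1
        have := hinj _ hkl _ (by omega) h2
        omega
      · have := hinj _ hk _ (by omega) h1
        have := hinj _ hkl _ (by omega) h2
        omega
    · rw [hwrap (by omega)] at hke
      rcases hke with ⟨h1, h2⟩ | ⟨h1, h2⟩
      · have := hinj _ (by omega) _ (by omega) h2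
        omega
      · have := hinj _ (by omega) _ (by omega) h2
        omega
  have a0 := c.adj_getVert_succ (i := 0) (by omega)
  have a1 := c.adj_getVert_succ (i := 1) (by omega)
  have a2 := c.adj_getVert_succ (i := c.length - 1) (by omega)
  have a3 := c.adj_getVert_succ (i := c.length - 2) (by omega)
  rw [c.getVert_zero] at a0
  rw [show c.length - 1 + 1 = c.length by omega, c.getVert_length] at a2
  rw [show c.length - 2 + 1 = c.length - 1 by omega] at a3
  have n1 := hnadj 2 (c.length - 1) (by omega) (by omega) (by omega)
  have n2 := hnadj 1 (c.length - 2) (by omega) (by omega) (by omega)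
  have s1 := hsup 2
  have s2 := hsup (c.length - 2)
  simp only [Nat.zero_add, Nat.reduceAdd] at a0 a1
  generalize c.getVert 1 = g1 at *
  generalize c.getVert 2 = g2 at *
  generalize c.getVert (c.length - 1) = g3 at *
  generalize c.getVert (c.length - 2) = g4 at *
  rcases g1 with w | e
  · exact absurd a0 (incG_adj_ll _ _ _)
  rcases g2 with y | e'
  swap
  · exact absurd a1 (incG_adj_rr _ _ _)
  rcases g3 with w | f
  · exact absurd a2 (incG_adj_ll _ _ _)
  rcases g4 with z | e'
  swap
  · exact absurd a3 (incG_adj_rr _ _ _)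
  rw [incG_adj_lr] at a0 a3 n1
  rw [incG_adj_rl] at a1 a2 n2
  exact ⟨e.1, e.2, f.1, f.2, a0, a2, ⟨y, s1, a1, n1⟩, z, s2, a3, n2⟩

theorem chord_of_elim {V : Type*} [Fintype V] [DecidableEq V] (E : Finset (Finset V))
    (l : List V) (hl : ∀ v, v ∈ l) (hel : ElimList l E) : ChordCond (incG E) := by
  intro v c hc hlen
  by_contra hno
  push Not at hno
  let S : Finset V := Finset.univ.filter (fun x => Sum.inl x ∈ c.support)
  have hS : ∀ x, x ∈ S ↔ Sum.inl x ∈ c.support := by intro x; simp [S]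
  refine no_elim_of_obstruct S ?_ l E (fun v _ => hl v) ?_ hel
  · have a0 := c.adj_getVert_succ (i := 0) (by omega)
    have s0 := c.getVert_mem_support 0
    have s1 := c.getVert_mem_support (0 + 1)
    generalize c.getVert 0 = g0 at *
    generalize c.getVert (0 + 1) = g1 at *
    rcases g0 with x | e
    · exact ⟨x, (hS x).mpr s0⟩
    · rcases g1 with x | f
      · exact ⟨x, (hS x).mpr s1⟩
      · exact absurd a0 (incG_adj_rr _ _ _)
  · intro x hx
    have hxs := (hS x).mp hx
    have hsupp : ∀ a, a ∈ (c.rotate _ hxs).support ↔ a ∈ c.support := by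
      intro a
      exact SimpleGraph.Walk.mem_support_rotate_iff ..
    have hedges : ∀ z, z ∈ (c.rotate _ hxs).edges ↔ z ∈ c.edges := fun z =>
      (c.rotate_edges _ hxs).mem_iff
    have hlen' : (c.rotate _ hxs).length = c.length := by
      rw [← SimpleGraph.Walk.length_edges, ← SimpleGraph.Walk.length_edges]
      exact (c.rotate_edges _ hxs).perm.length_eq
    obtain ⟨e, he, f, hf, h1, h2, ⟨y, hy, hy'⟩, z, hz, hz'⟩ :=
      obstruct_of_cycle E x (c.rotate _ hxs) (hc.rotate hxs) (by omega) (by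
        intro a b hab ha hb
        rw [hsupp] at ha hb
        rw [hedges]
        exact hno a b hab ha hb)
    rw [hsupp] at hy hz
    exact ⟨e, he, f, hf, h1, h2, ⟨y, (hS y).mpr hy, hy'⟩, z, (hS z).mpr hz, hz'⟩

/-- a hypergraph is β-acyclic iff its incidence graph is
chordal bipartite. -/
theorem stmt13 (E : Finset (Finset V)) (hE : ∀ e ∈ E, e ≠ ∅) :
    BetaAcyclic E ↔ ((incG E).Colorable 2 ∧ ChordCond (incG E)) := by
  constructor
  · rintro ⟨l, _, hl, hel⟩
    exact ⟨incG_colorable E, chord_of_elim E l hl hel⟩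
  · rintro ⟨_, hG⟩
    obtain ⟨l, h1, h2, h3⟩ := elim_of_nests E (exists_nest E hG) _ Finset.univ E rfl
      (fun e he => ⟨e, he, by simp⟩)
    exact ⟨l, h1, fun v => (h2 v).mpr (Finset.mem_univ v), h3⟩
end

section
/- Let G be a bipartite graph and G' the derived graph (with vertices x_v, y_v and p_{e,w}, q_{e,w}, complete bipartite graph on {x_v} vs {y_u}, and paths x_u p_{e,u} q_{e,u} y_v and x_v p_{e,v} q_{e,v} y_u for each edge e = uv). Then tw(G) ≤ 6 · mimw(G'), where tw is treewidth and mimw is MIM-width. -/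
open Finset
open scoped Classical

/-- Rooted binary trees with leaves labelled by `α`; used as (rooted) branch
decompositions. -/
inductive BT (α : Type*) : Type _
  | leaf : α → BT α
  | node : BT α → BT α → BT α

namespace BT

variable {α : Type*}

/-- The list of leaf labels of a tree. -/
def leafList : BT α → List α
  | leaf a => [a]
  | node l r => leafList l ++ leafList r

/-- `t` is a branch decomposition of (all of) `α`: every element of `α`
labels exactly one leaf. -/
def IsDecompOf [Fintype α] (t : BT α) : Prop :=
  t.leafList.Nodup ∧ ∀ a : α, a ∈ t.leafList

/-- The cuts of a branch decomposition: the leaf sets of all its subtrees. -/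
noncomputable def cuts [DecidableEq α] : BT α → Finset (Finset α)
  | leaf a => {{a}}
  | node l r => cuts l ∪ cuts r ∪ {(l.leafList ++ r.leafList).toFinset}

end BT

/-- The cut graph `G[X, X̄]` has an induced matching of size `m`: `m` edges of
`G` crossing the cut `(X, X̄)`, pairwise disjoint and with no `G`-edge crossing
the cut between endpoints of two different matching edges. -/
def CrossIndMatching {α : Type*} (G : SimpleGraph α) (X : Finset α) (m : ℕ) : Prop :=
  ∃ f : Fin m → α × α,
    (∀ i, (f i).1 ∈ X ∧ (f i).2 ∉ X ∧ G.Adj (f i).1 (f i).2) ∧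
    (∀ i j, i ≠ j →
      (f i).1 ≠ (f j).1 ∧ (f i).2 ≠ (f j).2 ∧ ¬ G.Adj (f i).1 (f j).2)

/-- The size of a maximum induced matching of the cut graph `G[X, X̄]`. -/
noncomputable def cutMim {α : Type*} (G : SimpleGraph α) (X : Finset α) : ℕ :=
  sSup {m | CrossIndMatching G X m}

/-- The MIM-width of a graph: the minimum over branch decompositions of the
maximum, over all cuts, of the maximum induced matching size of the cut graph. -/
noncomputable def mimw {α : Type*} [Fintype α] [DecidableEq α] (G : SimpleGraph α) : ℕ :=
  sInf {k | ∃ t : BT α, t.IsDecompOf ∧ ∀ X ∈ t.cuts, cutMim G X ≤ k}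

variable {V : Type*} [Fintype V] [DecidableEq V]

/-- Oriented edges `(u,v)` of a graph. -/
def OEdge (G : SimpleGraph V) : Type _ := {uv : V × V // G.Adj uv.1 uv.2}

/-- The derived graph `G'` of `G`: vertices `x_v`, `y_v` for `v ∈ V` and
`p_{e,u}, q_{e,u}` for each oriented edge `(u,v)` of `G`; a complete bipartite
graph on the `x_v` versus the `y_u`, and for each edge `e = uv` the paths
`x_u p_{e,u} q_{e,u} y_v` and `x_v p_{e,v} q_{e,v} y_u`. -/
def derived (G : SimpleGraph V) :
    SimpleGraph (V ⊕ V ⊕ OEdge G ⊕ OEdge G) :=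
  SimpleGraph.fromRel (fun a b =>
    match a, b with
    | Sum.inl _, Sum.inr (Sum.inl _) => True
    | Sum.inl u, Sum.inr (Sum.inr (Sum.inl d)) => d.1.1 = u
    | Sum.inr (Sum.inl v), Sum.inr (Sum.inr (Sum.inr d)) => d.1.2 = v
    | Sum.inr (Sum.inr (Sum.inl d)), Sum.inr (Sum.inr (Sum.inr d')) => d = d'
    | _, _ => False)

noncomputable instance (G : SimpleGraph V) : Fintype (OEdge G) := by
  unfold OEdge; exact Subtype.fintype _

instance (G : SimpleGraph V) : DecidableEq (OEdge G) := by
  unfold OEdge; infer_instance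

/-- The treewidth of a finite graph, defined via tree decompositions:
the least `k` such that some tree decomposition has all bags of size `≤ k+1`. -/
noncomputable def tw {α : Type*} [Fintype α] (G : SimpleGraph α) : ℕ :=
  sInf {k | ∃ (ι : Type) (_ : Fintype ι) (T : SimpleGraph ι) (B : ι → Finset α),
    T.IsTree ∧
    (∀ v : α, ∃ i, v ∈ B i) ∧
    (∀ u v : α, G.Adj u v → ∃ i, u ∈ B i ∧ v ∈ B i) ∧
    (∀ (v : α) (i j : ι) (p : T.Walk i j), p.IsPath →
      v ∈ B i → v ∈ B j → ∀ t ∈ p.support, v ∈ B t) ∧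
    (∀ i, (B i).card ≤ k + 1)}


namespace TWProof

/-- Partial tree decompositions, with root bag containing `R`. -/
def Good {α : Type*} (S R : Finset α) (P : α → α → Prop) (b : ℕ) : Prop :=
  ∃ (ι : Type) (_ : Fintype ι) (T : SimpleGraph ι) (B : ι → Finset α) (r : ι),
    T.IsTree ∧
    (∀ v ∈ S, ∃ i, v ∈ B i) ∧
    (∀ i, B i ⊆ S) ∧
    (∀ u v, P u v → ∃ i, u ∈ B i ∧ v ∈ B i) ∧
    (∀ (v : α) (i j : ι), v ∈ B i → v ∈ B j → ∃ p : T.Walk i j, ∀ t ∈ p.support, v ∈ B t) ∧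
    (∀ i, (B i).card ≤ b) ∧ R ⊆ B r

lemma good_single {α : Type*} (S : Finset α) (P : α → α → Prop) (b : ℕ) (hS : S.card ≤ b)
    (hP : ∀ u v, P u v → u ∈ S ∧ v ∈ S) : Good S S P b := by
  refine ⟨Unit, inferInstance, ⊥, fun _ => S, (), SimpleGraph.IsTree.of_subsingleton,
    fun v hv => ⟨(), hv⟩, fun _ => subset_rfl, fun u v h => ⟨(), hP u v h⟩, ?_, fun _ => hS,
    subset_rfl⟩
  intro v i j hi _
  exact ⟨SimpleGraph.Walk.nil, by simpa using hi⟩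

lemma isTree_join {ι κ : Type} [Fintype ι] [Fintype κ] (T : SimpleGraph ι) (U : SimpleGraph κ)
    (hT : T.IsTree) (hU : U.IsTree) (r : ι) (s : κ) :
    (T.sum U ⊔ SimpleGraph.edge (Sum.inl r) (Sum.inr s)).IsTree := by
  rw [SimpleGraph.isTree_iff_connected_and_card] at *
  refine ⟨hT.1.sum_sup_edge hU.1, ?_⟩
  rw [SimpleGraph.edgeSet_sup, SimpleGraph.edgeSet_edge_of_ne (by simp), Set.union_singleton]
  have h1 : s(Sum.inl r, Sum.inr s) ∉ (T.sum U).edgeSet := by simp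
  have h2 := Nat.card_congr (SimpleGraph.edgeSetSumEquiv (G := T) (H := U))
  rw [Nat.card_sum] at h2
  rw [Nat.card_coe_set_eq, Set.ncard_insert_of_notMem h1, ← Nat.card_coe_set_eq, h2, Nat.card_sum]
  omega

lemma walk_map {ι κ : Type} {T : SimpleGraph ι} {U : SimpleGraph κ} (f : ι → κ)
    (hf : ∀ a b, T.Adj a b → U.Adj (f a) (f b)) {i j : ι} (p : T.Walk i j) :
    ∃ q : U.Walk (f i) (f j), ∀ t ∈ q.support, ∃ a ∈ p.support, t = f a := by
  induction p with
  | nil => exact ⟨SimpleGraph.Walk.nil, by simp⟩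
  | cons h p ih =>
    obtain ⟨q, hq⟩ := ih
    refine ⟨SimpleGraph.Walk.cons (hf _ _ h) q, ?_⟩
    intro t ht
    rw [SimpleGraph.Walk.support_cons, List.mem_cons] at ht
    rcases ht with rfl | ht
    · exact ⟨_, by simp, rfl⟩
    · obtain ⟨a, ha, rfl⟩ := hq t ht
      exact ⟨a, by simp [ha], rfl⟩

lemma good_glue {α : Type*} {S₁ R₁ S₂ R₂ : Finset α} {P₁ P₂ : α → α → Prop} {b : ℕ}
    (h₁ : Good S₁ R₁ P₁ b) (h₂ : Good S₂ R₂ P₂ b)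
    (h : ∀ v, v ∈ S₁ → v ∈ S₂ → v ∈ R₁ ∧ v ∈ R₂) :
    Good (S₁ ∪ S₂) R₁ (fun u v => P₁ u v ∨ P₂ u v) b := by
  obtain ⟨ι, _, T, B, r, hT, hS, hB, hP, hW, hb, hR⟩ := h₁
  obtain ⟨κ, _, U, D, s, hU, hS', hD, hP', hW', hb', hR'⟩ := h₂
  have key : ∀ (v : α) (i : ι) (j : κ), v ∈ B i → v ∈ D j →
      ∃ p : (T.sum U ⊔ SimpleGraph.edge (Sum.inl r) (Sum.inr s)).Walk (Sum.inl i) (Sum.inr j),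
        ∀ t ∈ p.support, v ∈ Sum.elim B D t := by
    intro v i j hi hj
    obtain ⟨h1, h2⟩ := h v (hB i hi) (hD j hj)
    obtain ⟨p, hp⟩ := hW v i r hi (hR h1)
    obtain ⟨q, hq⟩ := hW' v s j (hR' h2) hj
    have hadj : (T.sum U ⊔ SimpleGraph.edge (Sum.inl r) (Sum.inr s)).Adj (Sum.inl r) (Sum.inr s) := by
      simp [SimpleGraph.edge]
    obtain ⟨p', hp'⟩ := walk_map (U := T.sum U ⊔ SimpleGraph.edge (Sum.inl r) (Sum.inr s))
      Sum.inl (fun a b h => Or.inl h) p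
    obtain ⟨q', hq'⟩ := walk_map (U := T.sum U ⊔ SimpleGraph.edge (Sum.inl r) (Sum.inr s))
      Sum.inr (fun a b h => Or.inl h) q
    refine ⟨p'.append (SimpleGraph.Walk.cons hadj q'), ?_⟩
    intro t ht
    rw [SimpleGraph.Walk.mem_support_append_iff, SimpleGraph.Walk.support_cons,
      List.mem_cons] at ht
    rcases ht with ht | rfl | ht
    · obtain ⟨a, ha, rfl⟩ := hp' t ht
      exact hp a ha
    · exact hR h1
    · obtain ⟨a, ha, rfl⟩ := hq' t ht
      exact hq a ha
  refine ⟨ι ⊕ κ, inferInstance, T.sum U ⊔ SimpleGraph.edge (Sum.inl r) (Sum.inr s),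
    Sum.elim B D, Sum.inl r, isTree_join T U hT hU r s, ?_, ?_, ?_, ?_, ?_, hR⟩
  · intro v hv
    rcases Finset.mem_union.1 hv with hv | hv
    · obtain ⟨i, hi⟩ := hS v hv; exact ⟨Sum.inl i, hi⟩
    · obtain ⟨i, hi⟩ := hS' v hv; exact ⟨Sum.inr i, hi⟩
  · rintro (i | i)
    · exact (hB i).trans Finset.subset_union_left
    · exact (hD i).trans Finset.subset_union_right
  · rintro u v (h | h)
    · obtain ⟨i, hi⟩ := hP u v h; exact ⟨Sum.inl i, hi⟩
    · obtain ⟨i, hi⟩ := hP' u v h; exact ⟨Sum.inr i, hi⟩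
  · rintro v (i | i) (j | j) hi hj
    · obtain ⟨p, hp⟩ := hW v i j hi hj
      obtain ⟨p', hp'⟩ := walk_map (U := T.sum U ⊔ SimpleGraph.edge (Sum.inl r) (Sum.inr s))
        Sum.inl (fun a b h => Or.inl h) p
      refine ⟨p', ?_⟩
      intro t ht
      obtain ⟨a, ha, rfl⟩ := hp' t ht
      exact hp a ha
    · exact key v i j hi hj
    · obtain ⟨p, hp⟩ := key v j i hj hi
      exact ⟨p.reverse, by simpa using! hp⟩
    · obtain ⟨p, hp⟩ := hW' v i j hi hj
      obtain ⟨p', hp'⟩ := walk_map (U := T.sum U ⊔ SimpleGraph.edge (Sum.inl r) (Sum.inr s))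
        Sum.inr (fun a b h => Or.inl h) p
      refine ⟨p', ?_⟩
      intro t ht
      obtain ⟨a, ha, rfl⟩ := hp' t ht
      exact hp a ha
  · rintro (i | i)
    · exact hb i
    · exact hb' i

lemma good_mono {α : Type*} {S R S' R' : Finset α} {P P' : α → α → Prop} {b : ℕ}
    (h : Good S R P b) (hS : S' = S) (hR : R' ⊆ R)
    (hP : ∀ u v, P' u v → P u v ∨ P v u) : Good S' R' P' b := by
  obtain ⟨ι, _, T, B, r, hT, hS1, hB, hP1, hW, hb, hR1⟩ := h
  subst hS
  refine ⟨ι, inferInstance, T, B, r, hT, hS1, hB, ?_, hW, hb, hR.trans hR1⟩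
  intro u v huv
  rcases hP u v huv with h | h
  · exact hP1 u v h
  · obtain ⟨i, hi, hj⟩ := hP1 v u h; exact ⟨i, hj, hi⟩

lemma tw_le_of_good {α : Type*} [Fintype α] (G : SimpleGraph α) {S R : Finset α} {P} {b : ℕ}
    (h : Good S R P (b + 1)) (hS : ∀ v, v ∈ S) (hP : ∀ u v, G.Adj u v → P u v) : tw G ≤ b := by
  obtain ⟨ι, _, T, B, r, hT, hS1, hB, hP1, hW, hb, hR1⟩ := h
  refine Nat.sInf_le ⟨ι, inferInstance, T, B, hT, fun v => hS1 v (hS v),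
    fun u v h => hP1 u v (hP u v h), ?_, hb⟩
  intro v i j p hp hi hj t ht
  obtain ⟨q, hq⟩ := hW v i j hi hj
  have : p = q.bypass := (hT.existsUnique_path i j).unique hp q.bypass_isPath
  subst this
  exact hq t (q.support_bypass_subset_support ht)

section cover
variable {α : Type*} [Fintype α] (G : SimpleGraph α)

/-- Neighbours of `A` outside `X`. -/
noncomputable def NB (X A : Finset α) : Finset α :=
  Finset.univ.filter (fun w => w ∉ X ∧ ∃ a ∈ A, G.Adj a w)

lemma mem_NB {X A : Finset α} {w : α} : w ∈ NB G X A ↔ w ∉ X ∧ ∃ a ∈ A, G.Adj a w := by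
  simp [NB]

/-- Minimal maximiser of the deficiency. -/
def IsMM (X A : Finset α) : Prop :=
  A ⊆ X ∧ ∀ D ⊆ X, ((D.card : ℤ) - (NB G X D).card ≤ A.card - (NB G X A).card) ∧
    ((D.card : ℤ) - (NB G X D).card = A.card - (NB G X A).card → A.card ≤ D.card)

lemma exists_MM (X : Finset α) : ∃ A, IsMM G X A := by
  obtain ⟨A0, hA0, hmax⟩ := Finset.exists_max_image X.powerset
    (fun D => (D.card : ℤ) - (NB G X D).card) ⟨∅, by simp⟩
  obtain ⟨A, hA, hmin⟩ := Finset.exists_min_image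
    (X.powerset.filter (fun D => (D.card : ℤ) - (NB G X D).card = A0.card - (NB G X A0).card))
    (fun D => D.card) ⟨A0, by simpa using hA0⟩
  simp only [Finset.mem_filter, Finset.mem_powerset] at hA hmin hmax
  refine ⟨A, hA.1, fun D hD => ⟨?_, fun h => hmin D ⟨hD, h.trans hA.2⟩⟩⟩
  rw [hA.2]; exact hmax D hD

lemma MM_mono {X Y A B : Finset α} (hXY : X ⊆ Y) (hA : IsMM G X A) (hB : IsMM G Y B) :
    A ⊆ B := by
  have h1 := hA.2 (A ∩ B) (Finset.inter_subset_left.trans hA.1)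
  have h2 := hB.2 (A ∪ B) (Finset.union_subset (hA.1.trans hXY) hB.1)
  have h3 : (A ∪ B).card + (A ∩ B).card = A.card + B.card := Finset.card_union_add_card_inter A B
  have h4 : (NB G Y (A ∪ B)).card + (NB G X (A ∩ B)).card
      ≤ (NB G X A).card + (NB G Y B).card := by
    have e1 : NB G Y (A ∪ B) ⊆ NB G Y B ∪ (NB G X A \ NB G X (A ∩ B)) ∪
        (NB G X (A ∩ B) ∩ NB G Y B) := by
      intro w
      simp only [Finset.mem_union, Finset.mem_inter, Finset.mem_sdiff, mem_NB]
      rintro ⟨hw, a, ha | ha, haw⟩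
      · by_cases hh : ∃ b ∈ B, G.Adj b w
        · exact Or.inl (Or.inl ⟨hw, hh⟩)
        · refine Or.inl (Or.inr ⟨⟨fun h => hw (hXY h), a, ha, haw⟩, ?_⟩)
          rintro ⟨_, c, hc, hcw⟩
          exact hh ⟨c, hc.2, hcw⟩
      · exact Or.inl (Or.inl ⟨hw, a, ha, haw⟩)
    have e2 : NB G Y B ∪ (NB G X A \ NB G X (A ∩ B)) ∪ (NB G X (A ∩ B) ∩ NB G Y B)
        = NB G Y B ∪ (NB G X A \ NB G X (A ∩ B)) := by
      apply Finset.union_eq_left.2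
      exact Finset.inter_subset_right.trans Finset.subset_union_left
    rw [e2] at e1
    have e3 := (Finset.card_le_card e1).trans (Finset.card_union_le _ _)
    have e4 : NB G X (A ∩ B) ⊆ NB G X A := by
      intro w
      simp only [mem_NB]
      rintro ⟨hw, a, ha, haw⟩
      exact ⟨hw, a, (Finset.mem_inter.1 ha).1, haw⟩
    have e5 := Finset.card_sdiff_add_card_eq_card e4
    omega
  have h5 : A.card ≤ (A ∩ B).card := by
    apply h1.2
    have := h1.1
    have := h2.1
    push_cast [← Nat.cast_inj (R := ℤ)] at *
    omega
  have := Finset.eq_of_subset_of_card_le Finset.inter_subset_left h5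
  exact Finset.inter_eq_left.1 this

lemma MM_lt {X A B : Finset α} (hB : Disjoint X B) (hA : IsMM G X A)
    {a b : α} (ha : a ∈ A) (hb : b ∈ B) (hab : G.Adj a b) :
    (B.filter (fun b => ∃ a ∈ A, G.Adj b a)).card <
      (A.filter (fun a => ∃ b ∈ B, G.Adj a b)).card := by
  set D := A.filter (fun a => ∃ b ∈ B, G.Adj a b) with hD
  set E := B.filter (fun b => ∃ a ∈ A, G.Adj b a) with hE
  have hDA : D ⊆ A := Finset.filter_subset _ _
  have hDne : 0 < D.card := Finset.card_pos.2 ⟨a, Finset.mem_filter.2 ⟨ha, b, hb, hab⟩⟩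
  have h1 := hA.2 (A \ D) (Finset.sdiff_subset.trans hA.1)
  have h2 := Finset.card_sdiff_add_card_eq_card hDA
  have h3 : (NB G X (A \ D)).card + E.card ≤ (NB G X A).card := by
    rw [← Finset.card_union_of_disjoint]
    · apply Finset.card_le_card
      intro w hw
      rcases Finset.mem_union.1 hw with hw | hw
      · obtain ⟨h, c, hc, hcw⟩ := (mem_NB G).1 hw
        exact (mem_NB G).2 ⟨h, c, (Finset.mem_sdiff.1 hc).1, hcw⟩
      · obtain ⟨h, c, hc, hcw⟩ := Finset.mem_filter.1 hw
        exact (mem_NB G).2 ⟨fun h' => Finset.disjoint_left.1 hB h' h, c, hc, hcw.symm⟩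
    · rw [Finset.disjoint_left]
      intro w hw hw'
      obtain ⟨h, c, hc, hcw⟩ := (mem_NB G).1 hw
      obtain ⟨hc1, hc2⟩ := Finset.mem_sdiff.1 hc
      exact hc2 (Finset.mem_filter.2 ⟨hc1, w, (Finset.mem_filter.1 hw').1, hcw⟩)
  by_contra hlt
  have := h1.1
  have := h1.2 (by omega)
  omega

lemma MM_nonadj {X Y A B : Finset α} (hXY : Disjoint X Y) (hA : IsMM G X A) (hB : IsMM G Y B)
    {a b : α} (ha : a ∈ A) (hb : b ∈ B) : ¬ G.Adj a b := by
  intro hab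
  have h1 := MM_lt G (hXY.mono_right hB.1) hA ha hb hab
  have h2 := MM_lt G (hXY.symm.mono_right hA.1) hB hb ha hab.symm
  omega

/-- The cover associated with `A`. -/
noncomputable def CV (X A : Finset α) : Finset α := (X \ A) ∪ NB G X A

lemma mem_CV {X A : Finset α} {w : α} :
    w ∈ CV G X A ↔ (w ∈ X ∧ w ∉ A) ∨ (w ∉ X ∧ ∃ a ∈ A, G.Adj a w) := by
  simp [CV, mem_NB]

/-- König via Hall with deficiency. -/
lemma exists_matching {X A : Finset α} (hA : IsMM G X A) :
    ∃ (M : Finset α) (f : α → α), M ⊆ X ∧ (CV G X A).card ≤ M.card ∧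
      (∀ u ∈ M, G.Adj u (f u) ∧ f u ∉ X) ∧ Set.InjOn f M := by
  have h0 := (hA.2 ∅ (by simp)).1
  have hN0 : NB G X ∅ = ∅ := by ext; simp [mem_NB]
  rw [hN0] at h0
  simp only [Finset.card_empty] at h0
  obtain ⟨d, hd⟩ : ∃ d : ℕ, A.card = (NB G X A).card + d := ⟨A.card - (NB G X A).card, by omega⟩
  have hall := (Finset.all_card_le_biUnion_card_iff_exists_injective
    (fun x : X => ((NB G X {x.1}).disjSum (Finset.univ : Finset (Fin d))))).1 (by
      intro s
      rcases s.eq_empty_or_nonempty with rfl | hs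
      · simp
      have h1 := (hA.2 (s.image Subtype.val) (by
        intro w hw; obtain ⟨x, _, rfl⟩ := Finset.mem_image.1 hw; exact x.2)).1
      rw [Finset.card_image_of_injective _ Subtype.val_injective] at h1
      have h2 : (NB G X (s.image Subtype.val)).disjSum (Finset.univ : Finset (Fin d)) ⊆
          s.biUnion (fun x : X => ((NB G X {x.1}).disjSum (Finset.univ : Finset (Fin d)))) := by
        intro w hw
        rw [Finset.mem_biUnion]
        rcases w with w | w
        · rw [Finset.inl_mem_disjSum, mem_NB] at hw
          obtain ⟨hw, a, ha, haw⟩ := hw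
          obtain ⟨x, hx, rfl⟩ := Finset.mem_image.1 ha
          exact ⟨x, hx, Finset.inl_mem_disjSum.2 ((mem_NB G).2 ⟨hw, x.1, by simp, haw⟩)⟩
        · obtain ⟨x, hx⟩ := hs
          exact ⟨x, hx, by simp⟩
      have h3 := Finset.card_le_card h2
      rw [Finset.card_disjSum, Finset.card_univ, Fintype.card_fin] at h3
      omega)
  obtain ⟨F, hF, hFm⟩ := hall
  let M' : Finset X := Finset.univ.filter (fun x => (F x).isLeft)
  have hMc : X.card ≤ M'.card + d := by
    have e1 := Finset.card_filter_add_card_filter_not (s := (Finset.univ : Finset X))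
      (fun x => (F x).isLeft = true)
    have e2 : (Finset.univ.filter (fun x : X => ¬ (F x).isLeft = true)).card ≤ d := by
      have : (Finset.univ.filter (fun x : X => ¬ (F x).isLeft = true)).image F ⊆
          (Finset.univ : Finset (Fin d)).image Sum.inr := by
        intro w hw
        obtain ⟨x, hx, rfl⟩ := Finset.mem_image.1 hw
        have hx := (Finset.mem_filter.1 hx).2
        cases hFx : F x with
        | inl a => simp [hFx] at hx
        | inr a => simp
      have := Finset.card_le_card this
      rw [Finset.card_image_of_injective _ hF] at this
      exact this.trans (Finset.card_image_le.trans (by simp))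
    have e3 : (Finset.univ : Finset X).card = X.card := by simp
    have e4 : M'.card = (Finset.univ.filter (fun x : X => (F x).isLeft = true)).card := rfl
    omega
  let f : α → α := fun u => if h : u ∈ X then Sum.elim id (fun _ => u) (F ⟨u, h⟩) else u
  have hf : ∀ x ∈ M', F x = Sum.inl (f x.1) := by
    intro x hx
    have hx := (Finset.mem_filter.1 hx).2
    cases hFx : F x with
    | inl a => simp [f, hFx]
    | inr a => simp [hFx] at hx
  refine ⟨M'.image Subtype.val, f, ?_, ?_, ?_, ?_⟩
  · intro w hw; obtain ⟨x, _, rfl⟩ := Finset.mem_image.1 hw; exact x.2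
  · rw [Finset.card_image_of_injective _ Subtype.val_injective]
    have e1 := Finset.card_union_le (X \ A) (NB G X A)
    have e2 := Finset.card_sdiff_add_card_eq_card hA.1
    unfold CV
    omega
  · intro u hu
    obtain ⟨x, hx, rfl⟩ := Finset.mem_image.1 hu
    have h1 := hFm x
    rw [hf x hx, Finset.inl_mem_disjSum, mem_NB] at h1
    obtain ⟨h2, a, ha, h3⟩ := h1
    rw [Finset.mem_singleton.1 ha] at h3
    exact ⟨h3, h2⟩
  · intro u hu v hv huv
    obtain ⟨x, hx, rfl⟩ := Finset.mem_image.1 hu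
    obtain ⟨y, hy, rfl⟩ := Finset.mem_image.1 hv
    have := hf x hx
    rw [huv, ← hf y hy] at this
    rw [hF this]

/-- The partial decomposition statement for a set `X`. -/
def GoodAt (X : Finset α) (b : ℕ) : Prop :=
  ∀ A, IsMM G X A → Good (X ∪ NB G X A) (CV G X A) (fun u v => u ∈ A ∧ G.Adj u v) b

lemma goodAt_small (X : Finset α) (hX : X.card ≤ 1) (b : ℕ) (hb : 1 ≤ b) : GoodAt G X b := by
  intro A hA
  have hc : (X ∪ NB G X A).card ≤ 1 := by
    rcases A.eq_empty_or_nonempty with rfl | hne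
    · have hN0 : NB G X ∅ = ∅ := by ext; simp [mem_NB]
      simpa [hN0] using hX
    · have h0 := hA.2 ∅ (by simp)
      have hN0 : NB G X ∅ = ∅ := by ext; simp [mem_NB]
      rw [hN0] at h0
      simp only [Finset.card_empty] at h0
      have h1 := hne.card_pos
      have h2 := Finset.card_le_card hA.1
      have h3 := Finset.card_union_le X (NB G X A)
      have h4 : (NB G X A).card ≠ A.card := by
        intro h; have := h0.2 (by omega); omega
      omega
  refine good_mono (good_single (X ∪ NB G X A) (fun u v => u ∈ A ∧ G.Adj u v) b (hc.trans hb) ?_)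
    rfl ?_ (fun u v h => Or.inl h)
  · rintro u v ⟨hu, huv⟩
    refine ⟨Finset.mem_union_left _ (hA.1 hu), ?_⟩
    by_cases hv : v ∈ X
    · exact Finset.mem_union_left _ hv
    · exact Finset.mem_union_right _ ((mem_NB G).2 ⟨hv, u, hu, huv⟩)
  · exact Finset.union_subset_union_left Finset.sdiff_subset

lemma goodAt_union {Y Z : Finset α} (hYZ : Disjoint Y Z) {b : ℕ}
    (hY : GoodAt G Y b) (hZ : GoodAt G Z b)
    (hc : ∀ A B C, IsMM G (Y ∪ Z) A → IsMM G Y B → IsMM G Z C →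
      (CV G (Y ∪ Z) A).card + (CV G Y B).card + (CV G Z C).card ≤ b) :
    GoodAt G (Y ∪ Z) b := by
  intro A hA
  obtain ⟨B, hB⟩ := exists_MM G Y
  obtain ⟨C, hC⟩ := exists_MM G Z
  have hcc := hc A B C hA hB hC
  have hBA := MM_mono G Finset.subset_union_left hB hA
  have hCA := MM_mono G Finset.subset_union_right hC hA
  have hBC : ∀ b ∈ B, ∀ c ∈ C, ¬ G.Adj b c := fun b hb c hc => MM_nonadj G hYZ hB hC hb hc
  have hdis := Finset.disjoint_left.1 hYZ
  have hBY := hB.1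
  have hCZ := hC.1
  have hAX := hA.1
  have g0 := good_single (CV G (Y ∪ Z) A ∪ CV G Y B ∪ CV G Z C)
    (fun u v => u ∈ (CV G (Y ∪ Z) A ∪ CV G Y B ∪ CV G Z C) ∧
      v ∈ (CV G (Y ∪ Z) A ∪ CV G Y B ∪ CV G Z C)) b
    (((Finset.card_union_le _ _).trans
      (Nat.add_le_add_right (Finset.card_union_le _ _) _)).trans hcc) (fun u v h => h)
  have g1 := good_glue g0 (hY B hB) (by
    intro v hv hv'
    refine ⟨hv, ?_⟩
    simp only [Finset.mem_union, mem_CV, mem_NB] at hv hv' ⊢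
    have := @hBY v
    have := @hBA v
    have := @hdis v
    by_cases hvB : v ∈ B
    · exfalso
      rcases hv with (hv | hv) | hv
      · grind
      · grind
      · rcases hv with hv | ⟨hv, c, hc, hcv⟩
        · grind
        · exact hBC v hvB c hc hcv.symm
    · grind)
  have g2 := good_glue g1 (hZ C hC) (by
    intro v hv hv'
    have hvC : v ∈ CV G Z C := by
      simp only [Finset.mem_union, mem_CV, mem_NB] at hv hv' ⊢
      have := @hCZ v
      have := @hCA v
      have := @hdis v
      by_cases hvC : v ∈ C
      · exfalso
        have hn : ¬ ∃ a ∈ B, G.Adj a v := by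
          rintro ⟨a, ha, hav⟩; exact hBC a ha v hvC hav
        grind
      · grind
    exact ⟨Finset.mem_union_right _ hvC, hvC⟩)
  refine good_mono g2 ?_ (Finset.subset_union_left.trans Finset.subset_union_left) ?_
  · ext v
    have h1 : (∃ a ∈ B, G.Adj a v) → ∃ a ∈ A, G.Adj a v := by
      rintro ⟨a, ha, hav⟩; exact ⟨a, hBA ha, hav⟩
    have h2 : (∃ a ∈ C, G.Adj a v) → ∃ a ∈ A, G.Adj a v := by
      rintro ⟨a, ha, hav⟩; exact ⟨a, hCA ha, hav⟩
    simp only [Finset.mem_union, mem_CV, mem_NB]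
    grind
  · rintro u v ⟨hu, huv⟩
    by_cases huB : u ∈ B
    · exact Or.inl (Or.inl (Or.inr ⟨huB, huv⟩))
    by_cases huC : u ∈ C
    · exact Or.inl (Or.inr ⟨huC, huv⟩)
    by_cases hvB : v ∈ B
    · exact Or.inr (Or.inl (Or.inr ⟨hvB, huv.symm⟩))
    by_cases hvC : v ∈ C
    · exact Or.inr (Or.inr ⟨hvC, huv.symm⟩)
    refine Or.inl (Or.inl (Or.inl ?_))
    have h1 : ∃ a ∈ A, G.Adj a v := ⟨u, hu, huv⟩
    have h2 := hAX hu
    simp only [Finset.mem_union, mem_CV] at h2 ⊢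
    grind

lemma tw_le_of_goodAt {b : ℕ} (h : GoodAt G Finset.univ (b + 1)) : tw G ≤ b := by
  obtain ⟨A, hA⟩ := exists_MM G Finset.univ
  have hAu : A = Finset.univ := by
    have h1 := (hA.2 Finset.univ subset_rfl).1
    have e : ∀ D, NB G Finset.univ D = ∅ := by intro D; ext; simp [mem_NB]
    rw [e, e] at h1
    exact Finset.eq_of_subset_of_card_le hA.1 (by simpa using h1)
  exact tw_le_of_good G (h A hA) (by simp) (fun u v huv => ⟨by simp [hAu], huv⟩)

end cover

lemma cross_of_family {β ι : Type*} (H : SimpleGraph β) (W : Finset β) (M : Finset ι)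
    (L : ι → β → Prop)
    (hL : ∀ d ∈ M, ∀ d' ∈ M, d ≠ d' → ∀ s t, L d s → L d' t → s ≠ t ∧ ¬ H.Adj s t)
    (h : ∀ d ∈ M, ∃ s t, s ∈ W ∧ t ∉ W ∧ H.Adj s t ∧ L d s ∧ L d t) :
    CrossIndMatching H W M.card := by
  choose s t hs ht hst hLs hLt using h
  refine ⟨fun i => (s _ (M.equivFin.symm i).2, t _ (M.equivFin.symm i).2), ?_, ?_⟩
  · intro i
    have hi := (M.equivFin.symm i).2
    exact ⟨hs _ hi, ht _ hi, hst _ hi⟩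
  · intro i j hij
    have hi := (M.equivFin.symm i).2
    have hj := (M.equivFin.symm j).2
    have hne : (M.equivFin.symm i).1 ≠ (M.equivFin.symm j).1 := by
      intro h; exact hij (M.equivFin.symm.injective (Subtype.ext h))
    exact ⟨(hL _ hi _ hj hne _ _ (hLs _ hi) (hLs _ hj)).1,
      (hL _ hi _ hj hne _ _ (hLt _ hi) (hLt _ hj)).1,
      (hL _ hi _ hj hne _ _ (hLs _ hi) (hLt _ hj)).2⟩

lemma cross_le {β : Type*} [Fintype β] {H : SimpleGraph β} {W : Finset β} {m : ℕ}
    (h : CrossIndMatching H W m) : m ≤ cutMim H W := by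
  refine le_csSup ⟨Fintype.card β, ?_⟩ h
  rintro n ⟨f, _, hf⟩
  have : Function.Injective (fun i => (f i).1) := by
    intro i j hij
    by_contra hne
    exact (hf i j hne).1 hij
  simpa using Fintype.card_le_of_injective _ this

section der
variable {U : Type*} [Fintype U] (G : SimpleGraph U)

/-- Vertices of the first part of the path. -/
def L1 (d : OEdge G) (s : U ⊕ U ⊕ OEdge G ⊕ OEdge G) : Prop :=
  s = Sum.inl d.1.1 ∨ s = Sum.inr (Sum.inr (Sum.inl d)) ∨ s = Sum.inr (Sum.inr (Sum.inr d))

/-- Vertices of the last part of the path. -/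
def L2 (d : OEdge G) (s : U ⊕ U ⊕ OEdge G ⊕ OEdge G) : Prop :=
  s = Sum.inr (Sum.inl d.1.2) ∨ s = Sum.inr (Sum.inr (Sum.inl d)) ∨
    s = Sum.inr (Sum.inr (Sum.inr d))

lemma edges_le {k : ℕ} (W : Finset (U ⊕ U ⊕ OEdge G ⊕ OEdge G)) (hW : cutMim (derived G) W ≤ k)
    (M : Finset (OEdge G))
    (hM : ∀ d ∈ M, ∀ d' ∈ M, d ≠ d' → d.1.1 ≠ d'.1.1 ∧ d.1.2 ≠ d'.1.2)
    (hc : ∀ d ∈ M, (Sum.inl d.1.1 ∈ W ∧ Sum.inr (Sum.inl d.1.2) ∉ W) ∨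
      (Sum.inl d.1.1 ∉ W ∧ Sum.inr (Sum.inl d.1.2) ∈ W)) : M.card ≤ 2 * k := by
  let Q : OEdge G → Prop := fun d => ∃ s t, s ∈ W ∧ t ∉ W ∧ (derived G).Adj s t ∧
    L1 G d s ∧ L1 G d t
  have h1 : (M.filter Q).card ≤ k := by
    refine le_trans (cross_le (cross_of_family (derived G) W (M.filter Q) (L1 G) ?_ ?_)) hW
    · intro d hd d' hd' hne s t hs ht
      have := hM d (Finset.mem_filter.1 hd).1 d' (Finset.mem_filter.1 hd').1 hne
      rcases hs with rfl | rfl | rfl <;> rcases ht with rfl | rfl | rfl <;>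
        simp [derived, hne, hne.symm, this.1, this.1.symm]
    · intro d hd; exact (Finset.mem_filter.1 hd).2
  have h2 : (M.filter (fun d => ¬ Q d)).card ≤ k := by
    refine le_trans (cross_le (cross_of_family (derived G) W (M.filter (fun d => ¬ Q d))
      (L2 G) ?_ ?_)) hW
    · intro d hd d' hd' hne s t hs ht
      have := hM d (Finset.mem_filter.1 hd).1 d' (Finset.mem_filter.1 hd').1 hne
      rcases hs with rfl | rfl | rfl <;> rcases ht with rfl | rfl | rfl <;>
        simp [derived, hne, hne.symm, this.2, this.2.symm]
    · intro d hd
      obtain ⟨hdM, hQ⟩ := Finset.mem_filter.1 hd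
      have a1 : (derived G).Adj (Sum.inl d.1.1) (Sum.inr (Sum.inr (Sum.inl d))) := by
        simp [derived]
      have a2 : (derived G).Adj (Sum.inr (Sum.inr (Sum.inl d)))
          (Sum.inr (Sum.inr (Sum.inr d))) := by simp [derived]
      have a3 : (derived G).Adj (Sum.inr (Sum.inr (Sum.inr d))) (Sum.inr (Sum.inl d.1.2)) := by
        simp [derived]
      have q1 : ∀ s t, (derived G).Adj s t → L1 G d s → L1 G d t → (s ∈ W ↔ t ∈ W) := by
        intro s t hst hs ht
        by_contra hh
        by_cases hsW : s ∈ W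
        · exact hQ ⟨s, t, hsW, fun h => hh (by simp [hsW, h]), hst, hs, ht⟩
        · exact hQ ⟨t, s, by by_contra h; exact hh (by simp [hsW, h]), hsW, hst.symm, ht, hs⟩
      have e1 := q1 _ _ a1 (Or.inl rfl) (Or.inr (Or.inl rfl))
      have e2 := q1 _ _ a2 (Or.inr (Or.inl rfl)) (Or.inr (Or.inr rfl))
      rw [e2] at e1
      rcases hc d hdM with ⟨h, h'⟩ | ⟨h, h'⟩
      · exact ⟨_, _, e1.1 h, h', a3, Or.inr (Or.inr rfl), Or.inl rfl⟩
      · exact ⟨_, _, h', fun h'' => h (e1.2 h''), a3.symm, Or.inl rfl, Or.inr (Or.inr rfl)⟩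
  have h3 := Finset.card_filter_add_card_filter_not (s := M) Q
  omega

/-- The vertex of the derived graph representing `v`. -/
noncomputable def ph (c : G.Coloring (Fin 2)) (v : U) : U ⊕ U ⊕ OEdge G ⊕ OEdge G :=
  if c v = 0 then Sum.inl v else Sum.inr (Sum.inl v)

/-- The set of represented vertices. -/
noncomputable def rep (c : G.Coloring (Fin 2)) (l : List (U ⊕ U ⊕ OEdge G ⊕ OEdge G)) : Finset U :=
  Finset.univ.filter (fun v => ph G c v ∈ l)

lemma ph_inj (c : G.Coloring (Fin 2)) : Function.Injective (ph G c) := by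
  intro u v h
  unfold ph at h
  split_ifs at h <;> simpa using h

/-- The oriented edge used for an edge `uv`, starting at colour `0`. -/
noncomputable def oe (c : G.Coloring (Fin 2)) (u v : U) (h : G.Adj u v) : OEdge G :=
  if c u = 0 then ⟨(u, v), h⟩ else ⟨(v, u), h.symm⟩

lemma oe_fst (c : G.Coloring (Fin 2)) (u v : U) (h : G.Adj u v) :
    (oe G c u v h).1.1 = if c u = 0 then u else v := by
  by_cases h0 : c u = 0
  · have e : oe G c u v h = ⟨(u, v), h⟩ := if_pos h0
    rw [e, if_pos h0]
  · have e : oe G c u v h = ⟨(v, u), h.symm⟩ := if_neg h0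
    rw [e, if_neg h0]

lemma oe_snd (c : G.Coloring (Fin 2)) (u v : U) (h : G.Adj u v) :
    (oe G c u v h).1.2 = if c u = 0 then v else u := by
  by_cases h0 : c u = 0
  · have e : oe G c u v h = ⟨(u, v), h⟩ := if_pos h0
    rw [e, if_pos h0]
  · have e : oe G c u v h = ⟨(v, u), h.symm⟩ := if_neg h0
    rw [e, if_neg h0]

lemma CV_le {k : ℕ} (c : G.Coloring (Fin 2)) (l : List (U ⊕ U ⊕ OEdge G ⊕ OEdge G))
    (hW : cutMim (derived G) l.toFinset ≤ k) (A : Finset U) (hA : IsMM G (rep G c l) A) :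
    (CV G (rep G c l) A).card ≤ 2 * k := by
  obtain ⟨M, f, hMX, hcard, hf, hinj⟩ := exists_matching G hA
  refine hcard.trans ?_
  have hmem : ∀ v, v ∈ rep G c l ↔ ph G c v ∈ l := by intro v; simp [rep]
  let E : M → OEdge G := fun u => oe G c u.1 (f u.1) (hf u.1 u.2).1
  have key : ∀ u v : M, u ≠ v → (E u).1.1 ≠ (E v).1.1 ∧ (E u).1.2 ≠ (E v).1.2 := by
    intro u v huv
    have h1 : u.1 ≠ v.1 := fun h => huv (Subtype.ext h)
    have h2 : f u.1 ≠ f v.1 := fun h => h1 (hinj u.2 v.2 h)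
    have h3 : u.1 ≠ f v.1 := fun h => (hf v.1 v.2).2 (h ▸ hMX u.2)
    have h4 : f u.1 ≠ v.1 := fun h => (hf u.1 u.2).2 (h ▸ hMX v.2)
    simp only [E, oe_fst, oe_snd]
    constructor <;> split_ifs <;> assumption
  have hE : Function.Injective E := by
    intro u v h
    by_contra hne
    exact (key u v hne).1 (by rw [h])
  have := edges_le G l.toFinset hW (Finset.univ.image E) ?_ ?_
  · rwa [Finset.card_image_of_injective _ hE, Finset.card_univ, Fintype.card_coe] at this
  · intro d hd d' hd' hne
    obtain ⟨u, _, rfl⟩ := Finset.mem_image.1 hd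
    obtain ⟨v, _, rfl⟩ := Finset.mem_image.1 hd'
    exact key u v (fun h => hne (by rw [h]))
  · intro d hd
    obtain ⟨u, _, rfl⟩ := Finset.mem_image.1 hd
    have h1 := (hmem _).1 (hMX u.2)
    have h2 : ph G c (f u.1) ∉ l := fun h => (hf u.1 u.2).2 ((hmem _).2 h)
    have h3 : c u.1 ≠ c (f u.1) := c.valid (hf u.1 u.2).1
    simp only [ph] at h1 h2
    simp only [E, oe_fst, oe_snd, List.mem_toFinset]
    by_cases hc : c u.1 = 0
    · have hc' : c (f u.1) ≠ 0 := fun h => h3 (hc.trans h.symm)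
      simp only [hc, hc', if_true, if_false] at h1 h2 ⊢
      exact Or.inl ⟨h1, h2⟩
    · have hc' : c (f u.1) = 0 := by omega
      simp only [hc, hc', if_true, if_false] at h1 h2 ⊢
      exact Or.inr ⟨h2, h1⟩

lemma root_mem_cuts {β : Type*} [DecidableEq β] (t : BT β) : t.leafList.toFinset ∈ t.cuts := by
  cases t <;> simp [BT.cuts, BT.leafList]

lemma goodAt_tree [DecidableEq (U ⊕ U ⊕ OEdge G ⊕ OEdge G)] {k : ℕ} (c : G.Coloring (Fin 2))
    (t : BT (U ⊕ U ⊕ OEdge G ⊕ OEdge G)) (hn : t.leafList.Nodup)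
    (ht : ∀ X ∈ t.cuts, cutMim (derived G) X ≤ k) :
    GoodAt G (rep G c t.leafList) (6 * k + 1) := by
  induction t with
  | leaf a =>
    apply goodAt_small _ _ _ _ (by omega)
    rw [Finset.card_le_one]
    intro u hu v hv
    simp only [rep, BT.leafList, List.mem_singleton, Finset.mem_filter] at hu hv
    exact ph_inj G c (hu.2.trans hv.2.symm)
  | node l r ihl ihr =>
    have hroot := ht _ (root_mem_cuts _)
    simp only [BT.leafList] at hn hroot ⊢
    have hl : ∀ X ∈ l.cuts, cutMim (derived G) X ≤ k := fun X hX => ht X (by simp [BT.cuts, hX])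
    have hr : ∀ X ∈ r.cuts, cutMim (derived G) X ≤ k := fun X hX => ht X (by simp [BT.cuts, hX])
    rw [List.nodup_append] at hn
    have e : rep G c (l.leafList ++ r.leafList) = rep G c l.leafList ∪ rep G c r.leafList := by
      ext v; simp [rep]
    rw [e]
    apply goodAt_union G ?_ (ihl hn.1 hl) (ihr hn.2.1 hr)
    · intro A B C hA hB hC
      rw [← e] at hA ⊢
      have h1 := CV_le G (k := k) c (l.leafList ++ r.leafList) (by convert hroot) A hA
      have h2 := CV_le G (k := k) c l.leafList (by convert hl _ (root_mem_cuts _)) B hB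
      have h3 := CV_le G (k := k) c r.leafList (by convert hr _ (root_mem_cuts _)) C hC
      omega
    · rw [Finset.disjoint_left]
      intro v hv hv'
      simp only [rep, Finset.mem_filter] at hv hv'
      exact hn.2.2 _ hv.2 _ hv'.2 rfl

end der

lemma exists_tree {β : Type*} (l : List β) (hl : l ≠ []) : ∃ t : BT β, t.leafList = l := by
  induction l with
  | nil => exact absurd rfl hl
  | cons a l ih =>
    by_cases h : l = []
    · exact ⟨BT.leaf a, by simp [BT.leafList, h]⟩
    · obtain ⟨t, ht⟩ := ih h
      exact ⟨BT.node (BT.leaf a) t, by simp [BT.leafList, ht]⟩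

lemma mimw_mem {β : Type*} [Fintype β] [DecidableEq β] [Nonempty β] (H : SimpleGraph β) :
    ∃ t : BT β, t.IsDecompOf ∧ ∀ X ∈ t.cuts, cutMim H X ≤ mimw H := by
  have : mimw H ∈ {k | ∃ t : BT β, t.IsDecompOf ∧ ∀ X ∈ t.cuts, cutMim H X ≤ k} := by
    apply Nat.sInf_mem
    obtain ⟨t, ht⟩ := exists_tree (Finset.univ : Finset β).toList (by simp [Finset.univ_nonempty.ne_empty])
    refine ⟨t.cuts.sup (cutMim H), t, ⟨?_, ?_⟩, fun X hX => Finset.le_sup hX⟩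
    · rw [ht]; exact Finset.nodup_toList _
    · intro a; rw [ht]; simp
  exact this

end TWProof

/-- for a bipartite graph `G`, `tw(G) ≤ 6 · mimw(G')`. -/
theorem stmt16 (G : SimpleGraph V) (hbip : G.Colorable 2) :
    tw G ≤ 6 * mimw (derived G) := by
  obtain ⟨c⟩ := hbip
  rcases isEmpty_or_nonempty V with hV | hV
  · apply TWProof.tw_le_of_goodAt
    apply TWProof.goodAt_small _ _ _ _ (by omega)
    simp
  · obtain ⟨t, ht, hk⟩ := TWProof.mimw_mem (derived G)
    have h := TWProof.goodAt_tree G c t ht.1 hk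
    have e : TWProof.rep G c t.leafList = Finset.univ := by
      ext v; simp [TWProof.rep, ht.2]
    rw [e] at h
    exact TWProof.tw_le_of_goodAt G h
end

section
/- There exists a family of chordal bipartite graphs G and a constant c > 0 such that mimw(G) ≥ c·|V(G)| for all graphs G in the family. Consequently, there is a family of monotone β-acyclic CNF-formulas whose PS-width is 2^{Ω(n)} in the number n of variables. -/
open Finset
open scoped Classical

variable {V : Type*} [Fintype V] [DecidableEq V]

/-- A clause over variables `V`. -/
abbrev Clause (V : Type*) := Finset V × Finset V

/-- The variables of a clause. -/
def cvars (C : Clause V) : Finset V := C.1 ∪ C.2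

/-- var(F). -/
def fvars (F : Finset (Clause V)) : Finset V := F.sup cvars

/-- `a` satisfies the clause `C`. -/
def csat (a : V → Bool) (C : Clause V) : Prop :=
  (∃ v ∈ C.1, a v = true) ∨ (∃ v ∈ C.2, a v = false)

/-- The PS-value of a formula: the number of precisely satisfiable clause sets. -/
noncomputable def psVal (F : Finset (Clause V)) : ℕ :=
  ((Finset.univ : Finset (V → Bool)).image
    (fun a => F.filter (fun C => csat a C))).card

/-- `F_{X,𝒞}`. -/
noncomputable def restrictF (X : Finset V) (Cs : Finset (Clause V)) : Finset (Clause V) :=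
  Cs.image (fun C => (C.1 ∩ X, C.2 ∩ X))

/-- The variable part of one side `A` of a cut of the incidence graph. -/
noncomputable def varsIn (F : Finset (Clause V)) (A : Finset (V ⊕ {C // C ∈ F})) :
    Finset V :=
  Finset.univ.filter (fun v => Sum.inl v ∈ A)

/-- The clause part of one side `A` of a cut of the incidence graph. -/
noncomputable def clsIn (F : Finset (Clause V)) (A : Finset (V ⊕ {C // C ∈ F})) :
    Finset (Clause V) :=
  (F.attach.filter (fun C => Sum.inr C ∈ A)).image Subtype.val

/-- `ps(A, Ā)`. -/
noncomputable def psCut (F : Finset (Clause V)) (A : Finset (V ⊕ {C // C ∈ F})) : ℕ :=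
  max (psVal (restrictF (varsIn F A) (clsIn F Aᶜ)))
      (psVal (restrictF (varsIn F Aᶜ) (clsIn F A)))

/-- The PS-width of a CNF-formula. -/
noncomputable def psw (F : Finset (Clause V)) : ℕ :=
  sInf {k | ∃ t : BT (V ⊕ {C // C ∈ F}), t.IsDecompOf ∧ ∀ A ∈ t.cuts, psCut F A ≤ k}

namespace Stmt17

/-- Existence of a sparse disperser. -/
lemma exists_disp (m : ℕ) (hm : 0 < m) :
    ∃ f : Fin (4 * m) × Fin 20 → Fin (4 * m),
      ∀ S T : Finset (Fin (4 * m)), m ≤ S.card → m ≤ T.card →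
        ∃ e, e.1 ∈ S ∧ f e ∈ T := by
  by_contra hcon
  push Not at hcon
  let R : Finset (Fin (4 * m)) × Finset (Fin (4 * m)) →
      Fin (4 * m) × Fin 20 → Finset (Fin (4 * m)) :=
    fun ST e => if e.1 ∈ ST.1 then ST.2ᶜ else Finset.univ
  let I : Finset (Finset (Fin (4 * m)) × Finset (Fin (4 * m))) :=
    (Finset.powersetCard m Finset.univ) ×ˢ (Finset.powersetCard m Finset.univ)
  have hcover : (Finset.univ : Finset (Fin (4 * m) × Fin 20 → Fin (4 * m))) ⊆
      I.biUnion (fun ST => Fintype.piFinset (R ST)) := by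
    intro f _
    obtain ⟨S, T, hS, hT, h⟩ := hcon f
    obtain ⟨S', hS', hSc⟩ := Finset.exists_subset_card_eq hS
    obtain ⟨T', hT', hTc⟩ := Finset.exists_subset_card_eq hT
    rw [Finset.mem_biUnion]
    refine ⟨(S', T'), ?_, ?_⟩
    · simp [I, Finset.mem_powersetCard, hSc, hTc]
    · rw [Fintype.mem_piFinset]
      intro e
      by_cases he : e.1 ∈ S'
      · simp only [R, he, if_true, Finset.mem_compl]
        exact fun h' => h e (hS' he) (hT' h')
      · simp [R, he]
  have hcard : ∀ ST ∈ I, (Fintype.piFinset (R ST)).card =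
      (3 * m) ^ (20 * m) * (4 * m) ^ (60 * m) := by
    rintro ⟨S, T⟩ hST
    simp only [I, Finset.mem_product, Finset.mem_powersetCard, Finset.subset_univ, true_and] at hST
    obtain ⟨hS, hT⟩ := hST
    rw [Fintype.card_piFinset, Fintype.prod_prod_type]
    have h1 : ∀ i : Fin (4 * m), ∏ k : Fin 20, (R (S, T) (i, k)).card =
        if i ∈ S then (3 * m) ^ 20 else (4 * m) ^ 20 := by
      intro i
      by_cases hi : i ∈ S
      · simp only [R, hi, if_true, Finset.card_compl, Fintype.card_fin, hT,
          Finset.prod_const, Finset.card_univ]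
        congr 1; omega
      · simp [R, hi]
    rw [Finset.prod_congr rfl (fun i _ => h1 i), Finset.prod_ite]
    simp only [Finset.prod_const]
    have h2 : (Finset.univ.filter (fun i => i ∈ S)).card = m := by
      simp [hS]
    have h3 : (Finset.univ.filter (fun i => i ∉ S)).card = 3 * m := by
      have : Finset.univ.filter (fun i => i ∉ S) = Sᶜ := by ext; simp
      rw [this, Finset.card_compl, Fintype.card_fin, hS]; omega
    rw [h2, h3, ← pow_mul, ← pow_mul]
    congr 2; ring
  have h := (Finset.card_le_card hcover).trans Finset.card_biUnion_le
  rw [Finset.sum_congr rfl hcard, Finset.sum_const, smul_eq_mul, Finset.card_univ] at h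
  have hI : I.card ≤ (2 ^ 8) ^ m := by
    have : (Finset.powersetCard m (Finset.univ : Finset (Fin (4 * m)))).card ≤ 2 ^ (4 * m) := by
      rw [Finset.card_powersetCard, Finset.card_univ, Fintype.card_fin]
      exact Nat.choose_le_two_pow _ _
    calc I.card = _ := Finset.card_product _ _
      _ ≤ 2 ^ (4 * m) * 2 ^ (4 * m) := Nat.mul_le_mul this this
      _ = (2 ^ 8) ^ m := by rw [← pow_add, ← pow_mul]; congr 1; ring
  have hF : Fintype.card (Fin (4 * m) × Fin 20 → Fin (4 * m)) = ((4 * m) ^ 80) ^ m := by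
    rw [Fintype.card_fun, Fintype.card_prod, Fintype.card_fin, Fintype.card_fin, ← pow_mul]
    congr 1; ring
  rw [hF] at h
  have h' : ((4 * m) ^ 80) ^ m ≤ (2 ^ 8 * 3 ^ 20 * m ^ 20 * (4 * m) ^ 60) ^ m := by
    refine h.trans ((Nat.mul_le_mul_right _ hI).trans (le_of_eq ?_))
    rw [pow_mul, pow_mul _ 60, ← mul_pow, ← mul_pow, mul_pow 3 m]
    congr 1; ring
  have hlt : 2 ^ 8 * 3 ^ 20 * m ^ 20 * (4 * m) ^ 60 < (4 * m) ^ 80 := by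
    have e : (4 * m) ^ 80 = (4 ^ 20 * m ^ 20) * (4 * m) ^ 60 := by
      rw [← mul_pow, ← pow_add]
    rw [e]
    apply Nat.mul_lt_mul_of_pos_right _ (by positivity)
    apply Nat.mul_lt_mul_of_pos_right _ (by positivity)
    norm_num
  have hfin := Nat.pow_lt_pow_left hlt hm.ne'
  exact absurd h' (not_le.mpr hfin)

/-- Matchings between large sets. -/
lemma exists_matching (j : ℕ) (f : Fin (4 * (9 * j)) × Fin 20 → Fin (4 * (9 * j)))
    (hf : ∀ S T : Finset (Fin (4 * (9 * j))), 9 * j ≤ S.card → 9 * j ≤ T.card →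
        ∃ e, e.1 ∈ S ∧ f e ∈ T)
    (S T : Finset (Fin (4 * (9 * j)))) (hS : 12 * j ≤ S.card) (hT : 12 * j ≤ T.card) :
    ∃ M : Finset (Fin (4 * (9 * j)) × Fin 20), M.card = 3 * j ∧
      (∀ e ∈ M, e.1 ∈ S ∧ f e ∈ T) ∧
      ∀ e ∈ M, ∀ e' ∈ M, e ≠ e' → e.1 ≠ e'.1 ∧ f e ≠ f e' := by
  suffices H : ∀ r ≤ 3 * j, ∃ M : Finset (Fin (4 * (9 * j)) × Fin 20), M.card = r ∧
      (∀ e ∈ M, e.1 ∈ S ∧ f e ∈ T) ∧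
      ∀ e ∈ M, ∀ e' ∈ M, e ≠ e' → e.1 ≠ e'.1 ∧ f e ≠ f e' from H _ le_rfl
  intro r
  induction r with
  | zero => intro _; exact ⟨∅, by simp⟩
  | succ r ih =>
    intro hr
    obtain ⟨M, hM, h1, h2⟩ := ih (by omega)
    have c1 : 9 * j ≤ (S \ M.image Prod.fst).card := by
      have := Finset.le_card_sdiff (M.image Prod.fst) S
      have := Finset.card_image_le (s := M) (f := Prod.fst)
      omega
    have c2 : 9 * j ≤ (T \ M.image f).card := by
      have := Finset.le_card_sdiff (M.image f) T
      have := Finset.card_image_le (s := M) (f := f)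
      omega
    obtain ⟨e, he1, he2⟩ := hf _ _ c1 c2
    rw [Finset.mem_sdiff] at he1 he2
    have k1 : ∀ e' ∈ M, e'.1 ≠ e.1 := fun e' he' hh =>
      he1.2 (Finset.mem_image.mpr ⟨e', he', hh⟩)
    have k2 : ∀ e' ∈ M, f e' ≠ f e := fun e' he' hh =>
      he2.2 (Finset.mem_image.mpr ⟨e', he', hh⟩)
    have heM : e ∉ M := fun h => k1 e h rfl
    refine ⟨insert e M, by rw [Finset.card_insert_of_notMem heM, hM], ?_, ?_⟩
    · intro e' he'
      rcases Finset.mem_insert.mp he' with rfl | h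
      · exact ⟨he1.1, he2.1⟩
      · exact h1 _ h
    · intro x hx y hy hxy
      rcases Finset.mem_insert.mp hx with hx | hx <;> rcases Finset.mem_insert.mp hy with hy | hy
      · exact absurd (hx.trans hy.symm) hxy
      · exact hx ▸ ⟨(k1 _ hy).symm, (k2 _ hy).symm⟩
      · exact hy ▸ ⟨k1 _ hx, k2 _ hx⟩
      · exact h2 _ hx _ hy hxy

/-- Balanced cuts of a branch decomposition. -/
lemma balanced {α : Type*} [DecidableEq α] {n : ℕ} (a : Fin n → α) (ha : Function.Injective a)
    (k : ℕ) (hk : 0 < k) (t : BT α)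
    (h : k ≤ (Finset.univ.filter (fun i => a i ∈ t.leafList)).card) :
    ∃ X ∈ t.cuts, k ≤ (Finset.univ.filter (fun i => a i ∈ X)).card ∧
      (Finset.univ.filter (fun i => a i ∈ X)).card < 2 * k := by
  induction t with
  | leaf x =>
    refine ⟨{x}, by simp [BT.cuts], ?_, ?_⟩
    · simpa [BT.leafList] using h
    · have : (Finset.univ.filter (fun i => a i ∈ ({x} : Finset α))).card ≤ 1 := by
        rw [Finset.card_le_one]
        intro i hi i' hi'
        simp at hi hi'
        exact ha (hi.trans hi'.symm)
      omega
  | node l r ihl ihr =>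
    by_cases h2 : (Finset.univ.filter (fun i => a i ∈ (BT.node l r).leafList)).card < 2 * k
    · refine ⟨(l.leafList ++ r.leafList).toFinset, by simp [BT.cuts], ?_, ?_⟩
      · simpa [BT.leafList] using h
      · simpa [BT.leafList] using h2
    · have hu : (Finset.univ.filter (fun i => a i ∈ (BT.node l r).leafList)).card ≤
          (Finset.univ.filter (fun i => a i ∈ l.leafList)).card +
          (Finset.univ.filter (fun i => a i ∈ r.leafList)).card := by
        refine le_trans (Finset.card_le_card ?_) (Finset.card_union_le _ _)
        intro i hi
        simpa [BT.leafList] using hi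
      by_cases hl : k ≤ (Finset.univ.filter (fun i => a i ∈ l.leafList)).card
      · obtain ⟨X, hX, h⟩ := ihl hl
        exact ⟨X, by simp [BT.cuts, hX], h⟩
      · obtain ⟨X, hX, h⟩ := ihr (by omega)
        exact ⟨X, by simp [BT.cuts, hX], h⟩

lemma mk_cross {α ε : Type*} (G : SimpleGraph α) (X : Finset α) (j : ℕ) (M : Finset ε)
    (hM : j ≤ M.card) (u v : ε → α) (h1 : ∀ e ∈ M, u e ∈ X) (h2 : ∀ e ∈ M, v e ∉ X)
    (h3 : ∀ e ∈ M, G.Adj (u e) (v e))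
    (h4 : ∀ e ∈ M, ∀ e' ∈ M, e ≠ e' → ¬ G.Adj (u e) (v e')) : CrossIndMatching G X j := by
  let g : Fin j → M := fun i => M.equivFin.symm (Fin.castLE hM i)
  have hg : Function.Injective g := fun i i' h => by
    simpa [g] using h
  refine ⟨fun i => (u (g i), v (g i)), fun i => ⟨h1 _ (g i).2, h2 _ (g i).2, h3 _ (g i).2⟩, ?_⟩
  intro i i' hi
  have hne : (g i : ε) ≠ g i' := fun h => hi (hg (Subtype.ext h))
  have n1 := h4 _ (g i).2 _ (g i').2 hne
  refine ⟨fun h => n1 ?_, fun h => n1 ?_, n1⟩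
  · have := h3 _ (g i').2
    simp only at h
    rwa [← h] at this
  · have := h3 _ (g i).2
    simp only at h
    rwa [h] at this

lemma three_split {ε : Type*} (M : Finset ε) (j : ℕ) (hM : M.card = 3 * j) (P Q : ε → Prop) :
    j ≤ (M.filter P).card ∨ j ≤ (M.filter (fun e => ¬ P e ∧ Q e)).card ∨
      j ≤ (M.filter (fun e => ¬ P e ∧ ¬ Q e)).card := by
  have h : M ⊆ M.filter P ∪ (M.filter (fun e => ¬ P e ∧ Q e) ∪
      M.filter (fun e => ¬ P e ∧ ¬ Q e)) := by
    intro e he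
    simp only [Finset.mem_union, Finset.mem_filter]
    tauto
  have h1 := (Finset.card_le_card h).trans (Finset.card_union_le _ _)
  have h2 := Finset.card_union_le (M.filter (fun e => ¬ P e ∧ Q e))
    (M.filter (fun e => ¬ P e ∧ ¬ Q e))
  omega

lemma big_cut {α : Type*} [Fintype α] [DecidableEq α] (G : SimpleGraph α) (j : ℕ) (hj : 0 < j)
    (f : Fin (4 * (9 * j)) × Fin 20 → Fin (4 * (9 * j)))
    (hf : ∀ S T : Finset (Fin (4 * (9 * j))), 9 * j ≤ S.card → 9 * j ≤ T.card →
        ∃ e, e.1 ∈ S ∧ f e ∈ T)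
    (a b : Fin (4 * (9 * j)) → α) (p q : Fin (4 * (9 * j)) × Fin 20 → α)
    (ha : Function.Injective a)
    (hap : ∀ i e, G.Adj (a i) (p e) ↔ e.1 = i)
    (hpq : ∀ e e', G.Adj (p e) (q e') ↔ e = e')
    (hqb : ∀ e i, G.Adj (q e) (b i) ↔ f e = i)
    (t : BT α) (ht : t.IsDecompOf) :
    ∃ X ∈ t.cuts, CrossIndMatching G X j := by
  obtain ⟨X, hX, h1, h2⟩ := balanced a ha (12 * j) (by omega) t (by
    have : Finset.univ.filter (fun i => a i ∈ t.leafList) = Finset.univ := by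
      ext i; simp [ht.2]
    rw [this, Finset.card_univ, Fintype.card_fin]; omega)
  refine ⟨X, hX, ?_⟩
  have hSc := Finset.card_filter_add_card_filter_not (s := Finset.univ) (fun i => a i ∈ X)
  have hTc := Finset.card_filter_add_card_filter_not (s := Finset.univ) (fun i => b i ∈ X)
  rw [Finset.card_univ, Fintype.card_fin] at hSc hTc
  by_cases hT : 12 * j ≤ (Finset.univ.filter (fun i => ¬ b i ∈ X)).card
  · obtain ⟨M, hM, hM1, hM2⟩ := exists_matching j f hf _ _ h1 hT
    simp only [Finset.mem_filter, Finset.mem_univ, true_and] at hM1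
    rcases three_split M j hM (fun e => p e ∉ X) (fun e => q e ∉ X) with h | h | h
    · refine mk_cross G X j _ h (fun e => a e.1) p ?_ ?_ ?_ ?_ <;>
        simp only [Finset.mem_filter]
      · exact fun e he => (hM1 e he.1).1
      · exact fun e he => he.2
      · exact fun e _ => (hap _ _).2 rfl
      · exact fun e he e' he' hne h => (hM2 e he.1 e' he'.1 hne).1 ((hap _ _).1 h).symm
    · refine mk_cross G X j _ h p q ?_ ?_ ?_ ?_ <;>
        simp only [Finset.mem_filter, not_not]
      · exact fun e he => he.2.1
      · exact fun e he => he.2.2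
      · exact fun e _ => (hpq _ _).2 rfl
      · exact fun e he e' he' hne h => hne ((hpq _ _).1 h)
    · refine mk_cross G X j _ h q (fun e => b (f e)) ?_ ?_ ?_ ?_ <;>
        simp only [Finset.mem_filter, not_not]
      · exact fun e he => he.2.2
      · exact fun e he => (hM1 e he.1).2
      · exact fun e _ => (hqb _ _).2 rfl
      · exact fun e he e' he' hne h => (hM2 e he.1 e' he'.1 hne).2 ((hqb _ _).1 h)
  · obtain ⟨M, hM, hM1, hM2⟩ := exists_matching j f hf
      (Finset.univ.filter (fun i => ¬ a i ∈ X)) (Finset.univ.filter (fun i => b i ∈ X))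
      (by omega) (by omega)
    simp only [Finset.mem_filter, Finset.mem_univ, true_and] at hM1
    rcases three_split M j hM (fun e => p e ∈ X) (fun e => q e ∈ X) with h | h | h
    · refine mk_cross G X j _ h p (fun e => a e.1) ?_ ?_ ?_ ?_ <;>
        simp only [Finset.mem_filter]
      · exact fun e he => he.2
      · exact fun e he => (hM1 e he.1).1
      · exact fun e _ => ((hap _ _).2 rfl).symm
      · exact fun e he e' he' hne h => (hM2 e he.1 e' he'.1 hne).1 ((hap _ _).1 h.symm)
    · refine mk_cross G X j _ h q p ?_ ?_ ?_ ?_ <;>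
        simp only [Finset.mem_filter]
      · exact fun e he => he.2.2
      · exact fun e he => he.2.1
      · exact fun e _ => ((hpq _ _).2 rfl).symm
      · exact fun e he e' he' hne h => hne ((hpq _ _).1 h.symm).symm
    · refine mk_cross G X j _ h (fun e => b (f e)) q ?_ ?_ ?_ ?_ <;>
        simp only [Finset.mem_filter]
      · exact fun e he => (hM1 e he.1).2
      · exact fun e he => he.2.2
      · exact fun e _ => ((hqb _ _).2 rfl).symm
      · exact fun e he e' he' hne h => (hM2 e he.1 e' he'.1 hne).2 ((hqb _ _).1 h.symm).symm

lemma exists_decomp_aux {α : Type*} : ∀ l : List α, l ≠ [] → ∃ t : BT α, t.leafList = l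
  | [], h => absurd rfl h
  | [x], _ => ⟨BT.leaf x, rfl⟩
  | x :: y :: l, _ => by
    obtain ⟨t, ht⟩ := exists_decomp_aux (y :: l) (by simp)
    exact ⟨BT.node (BT.leaf x) t, by simp [BT.leafList, ht]⟩

lemma exists_decomp {α : Type*} [Fintype α] [Nonempty α] : ∃ t : BT α, t.IsDecompOf := by
  obtain ⟨t, ht⟩ := exists_decomp_aux (Finset.univ : Finset α).toList (by
    simp [Finset.univ_eq_empty_iff])
  exact ⟨t, by rw [ht]; exact Finset.nodup_toList _, fun a => by rw [ht]; simp⟩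

lemma width_lower {α : Type*} [Fintype α] [DecidableEq α] [Nonempty α] (w : Finset α → ℕ) (r : ℕ)
    (h : ∀ t : BT α, t.IsDecompOf → ∃ X ∈ t.cuts, r ≤ w X) :
    r ≤ sInf {k | ∃ t : BT α, t.IsDecompOf ∧ ∀ X ∈ t.cuts, w X ≤ k} := by
  apply le_csInf
  · obtain ⟨t, ht⟩ := exists_decomp (α := α)
    exact ⟨t.cuts.sup w, t, ht, fun X hX => Finset.le_sup hX⟩
  · rintro k ⟨t, ht, hk⟩
    obtain ⟨X, hX, hr⟩ := h t ht
    exact hr.trans (hk X hX)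

lemma le_cutMim {α : Type*} [Fintype α] (G : SimpleGraph α) (X : Finset α) (j : ℕ)
    (h : CrossIndMatching G X j) : j ≤ cutMim G X := by
  refine le_csSup (s := {m | CrossIndMatching G X m}) ?_ h
  refine ⟨Fintype.card α, ?_⟩
  rintro m ⟨f, -, hf⟩
  have : Function.Injective (fun i => (f i).1) := by
    intro i i' h
    by_contra hne
    exact (hf i i' hne).1 h
  simpa using Fintype.card_le_of_injective _ this

/-- Edge indices. -/
abbrev Ed (n : ℕ) := Fin n × Fin 20

/-- The vertices of the chordal bipartite graph. -/
abbrev W (n : ℕ) := (Fin n ⊕ Fin n) ⊕ (Ed n ⊕ Ed n)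

/-- The (directed) incidence relation. -/
def rel {n : ℕ} (f : Ed n → Fin n) : W n → W n → Prop
  | .inl (.inl _), .inl (.inr _) => True
  | .inl (.inl i), .inr (.inl e) => e.1 = i
  | .inr (.inr e), .inr (.inl e') => e' = e
  | .inr (.inr e), .inl (.inr v) => f e = v
  | _, _ => False

/-- The chordal bipartite graph. -/
def HG {n : ℕ} (f : Ed n → Fin n) : SimpleGraph (W n) where
  Adj x y := rel f x y ∨ rel f y x
  symm := ⟨fun _ _ h => h.symm⟩
  loopless := ⟨fun x h => by
    rcases x with (x | x) | (x | x) <;> simp [rel] at h⟩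

lemma HG_colorable {n : ℕ} (f : Ed n → Fin n) : (HG f).Colorable 2 := by
  refine ⟨SimpleGraph.Coloring.mk (fun x : W n => match x with
    | .inl (.inl _) => (0 : Fin 2)
    | .inl (.inr _) => 1
    | .inr (.inl _) => 1
    | .inr (.inr _) => 0) ?_⟩
  rintro ((x | x) | (x | x)) ((y | y) | (y | y)) h <;> simp [HG, rel] at h ⊢

lemma walk_closed {α : Type*} {G : SimpleGraph α} (S : Set α) {u v : α} (w : G.Walk u v)
    (h : ∀ x y, s(x, y) ∈ w.edges → x ∈ S → y ∈ S) (hu : u ∈ S) :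
    ∀ x ∈ w.support, x ∈ S := by
  induction w with
  | nil => intro x hx; simp at hx; exact hx ▸ hu
  | cons hadj w ih =>
    intro x hx
    rw [SimpleGraph.Walk.support_cons, List.mem_cons] at hx
    rcases hx with rfl | hx
    · exact hu
    · refine ih (fun x y hxy => h x y (by simp [hxy])) (h _ _ (by simp) hu) x hx

lemma two_nbr {α : Type*} {G : SimpleGraph α} {v : α} (c : G.Walk v v) (hc : c.IsCycle)
    (x : α) (hx : x ∈ c.support) :
    ∃ y z, y ≠ z ∧ ∀ w, s(x, w) ∈ c.edges ↔ (w = y ∨ w = z) := by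
  have h := hc.ncard_neighborSet_toSubgraph_eq_two hx
  obtain ⟨y, z, hyz, h⟩ := Set.ncard_eq_two.mp h
  refine ⟨y, z, hyz, fun w => ?_⟩
  have : w ∈ c.toSubgraph.neighborSet x ↔ w ∈ ({y, z} : Set α) := by rw [h]
  rw [SimpleGraph.Subgraph.mem_neighborSet,
    SimpleGraph.Walk.adj_toSubgraph_iff_mem_edges] at this
  simpa using this

lemma small_support {α : Type*} [DecidableEq α] {G : SimpleGraph α} {v : α} (c : G.Walk v v)
    (hc : c.IsCycle) (hl : 6 ≤ c.length) (x y z w : α)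
    (h : ∀ u ∈ c.support, u = x ∨ u = y ∨ u = z ∨ u = w) : False := by
  have h1 : c.support.tail.toFinset ⊆ {x, y, z, w} := by
    intro u hu
    rw [List.mem_toFinset] at hu
    simpa using h u (List.mem_of_mem_tail hu)
  have h2 := (Finset.card_le_card h1).trans Finset.card_le_four
  rw [List.toFinset_card_of_nodup hc.support_nodup] at h2
  simp at h2
  omega

lemma HG_chord {n : ℕ} (f : Ed n → Fin n) : ChordCond (HG f) := by
  intro v c hc hl
  by_contra hno
  push Not at hno
  have tn := two_nbr c hc
  have adj : ∀ {x y}, s(x, y) ∈ c.edges → (HG f).Adj x y :=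
    fun h => c.adj_of_mem_edges h
  have mem2 : ∀ {x y}, s(x, y) ∈ c.edges → y ∈ c.support :=
    fun h => c.snd_mem_support_of_mem_edges h
  have nP : ∀ e w, (HG f).Adj (.inr (.inl e)) w → w = .inl (.inl e.1) ∨ w = .inr (.inr e) := by
    rintro e ((x | x) | (x | x)) h <;> simp [HG, rel] at h ⊢ <;> simp [h]
  have nQ : ∀ e w, (HG f).Adj (.inr (.inr e)) w →
      w = .inl (.inr (f e)) ∨ w = .inr (.inl e) := by
    rintro e ((x | x) | (x | x)) h <;> simp [HG, rel] at h ⊢ <;> simp [h]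
  have keyP : ∀ e, .inr (.inl e) ∈ c.support → False := by
    intro e he
    obtain ⟨y, z, hyz, hP⟩ := tn _ he
    have hy := nP _ _ (adj ((hP y).2 (Or.inl rfl)))
    have hz := nP _ _ (adj ((hP z).2 (Or.inr rfl)))
    have ePA : s(.inr (.inl e), .inl (.inl e.1)) ∈ c.edges := by
      rw [hP]; grind
    have ePQ : s(.inr (.inl e), .inr (.inr e)) ∈ c.edges := by
      rw [hP]; grind
    obtain ⟨y', z', hyz', hQ⟩ := tn _ (mem2 ePQ)
    have hy' := nQ _ _ (adj ((hQ y').2 (Or.inl rfl)))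
    have hz' := nQ _ _ (adj ((hQ z').2 (Or.inr rfl)))
    have eQB : s(.inr (.inr e), .inl (.inr (f e))) ∈ c.edges := by
      rw [hQ]; grind
    have eAB : s(.inl (.inl e.1), .inl (.inr (f e))) ∈ c.edges :=
      hno _ _ (by simp [HG, rel]) (mem2 ePA) (mem2 eQB)
    obtain ⟨y1, z1, hyz1, hA⟩ := tn _ (mem2 ePA)
    obtain ⟨y2, z2, hyz2, hB⟩ := tn _ (mem2 eQB)
    have a1 := (hA _).1 eAB
    have a2 := (hA _).1 (Sym2.eq_swap ▸ ePA)
    have b1 := (hB _).1 (Sym2.eq_swap ▸ eAB)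
    have b2 := (hB _).1 (Sym2.eq_swap ▸ eQB)
    let S : Set (W n) := {x | x = .inr (.inl e) ∨ x = .inr (.inr e) ∨
      x = .inl (.inl e.1) ∨ x = .inl (.inr (f e))}
    have hcl : ∀ x y, s(x, y) ∈ c.edges → x ∈ S → y ∈ S := by
      intro x y hxy hx
      simp only [S, Set.mem_ofPred_eq] at hx ⊢
      rcases hx with rfl | rfl | rfl | rfl
      · rcases nP _ _ (adj hxy) with h | h <;> simp [h]
      · rcases nQ _ _ (adj hxy) with h | h <;> simp [h]
      · have := (hA _).1 hxy
        grind
      · have := (hB _).1 hxy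
        grind
    have hsup : ∀ x ∈ c.support, x ∈ S := by
      intro x hx
      refine walk_closed S (c.rotate _ he) ?_ ?_ x ?_
      · intro x y hxy
        exact hcl x y ((c.rotate_edges _ he).perm.mem_iff.1 hxy)
      · simp [S]
      · simpa using hx
    exact small_support c hc hl _ _ _ _ hsup
  have keyQ : ∀ e, .inr (.inr e) ∈ c.support → False := by
    intro e he
    obtain ⟨y, z, hyz, hQ⟩ := tn _ he
    have ey := (hQ y).2 (Or.inl rfl)
    have ez := (hQ z).2 (Or.inr rfl)
    have hy := nQ _ _ (adj ey)
    have hz := nQ _ _ (adj ez)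
    have : y = .inr (.inl e) ∨ z = .inr (.inl e) := by grind
    rcases this with rfl | rfl
    · exact keyP e (mem2 ey)
    · exact keyP e (mem2 ez)
  have hAB : ∃ i k, .inl (.inl i) ∈ c.support ∧ .inl (.inr k) ∈ c.support := by
    obtain ⟨y, z, hyz, hv⟩ := tn v c.start_mem_support
    have ey := (hv y).2 (Or.inl rfl)
    have hy := mem2 ey
    have hadj := adj ey
    have hvs := c.start_mem_support
    rcases v with (v | v) | (v | v)
    · rcases y with (y | y) | (y | y)
      · simp [HG, rel] at hadj
      · exact ⟨_, _, hvs, hy⟩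
      · exact (keyP _ hy).elim
      · exact (keyQ _ hy).elim
    · rcases y with (y | y) | (y | y)
      · exact ⟨_, _, hy, hvs⟩
      · simp [HG, rel] at hadj
      · exact (keyP _ hy).elim
      · exact (keyQ _ hy).elim
    · exact (keyP _ hvs).elim
    · exact (keyQ _ hvs).elim
  obtain ⟨i, k, hi, hk⟩ := hAB
  obtain ⟨y, z, -, hA⟩ := tn _ hi
  obtain ⟨y', z', -, hB⟩ := tn _ hk
  refine small_support c hc hl y z y' z' ?_
  rintro ((x | x) | (x | x)) hx
  · have := (hB _).1 (hno (.inl (.inr k)) (.inl (.inl x)) (by simp [HG, rel]) hk hx)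
    tauto
  · have := (hA _).1 (hno (.inl (.inl i)) (.inl (.inr x)) (by simp [HG, rel]) hi hx)
    tauto
  · exact (keyP _ hx).elim
  · exact (keyQ _ hx).elim

lemma chord_comap {α β : Type*} (G : SimpleGraph β) (g : α → β) (hg : Function.Injective g)
    (h : ChordCond G) : ChordCond (G.comap g) := by
  intro v c hc hl
  let φ : G.comap g →g G := ⟨g, fun h => h⟩
  have hφ : Function.Injective φ := hg
  obtain ⟨a, b, hab, ha, hb, he⟩ := h _ (c.map φ)
    ((SimpleGraph.Walk.isCycle_map_iff_of_injective hφ).2 hc) (by simpa using hl)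
  rw [SimpleGraph.Walk.support_map, List.mem_map] at ha hb
  obtain ⟨a, ha, rfl⟩ := ha
  obtain ⟨b, hb, rfl⟩ := hb
  refine ⟨a, b, hab, ha, hb, fun hh => he ?_⟩
  rw [SimpleGraph.Walk.edges_map, List.mem_map]
  exact ⟨_, hh, by simp⟩

lemma part_one : ∃ c : ℝ, 0 < c ∧ ∀ N : ℕ, ∃ (m : ℕ) (G : SimpleGraph (Fin m)),
      N ≤ m ∧ G.Colorable 2 ∧ ChordCond G ∧ c * (m : ℝ) ≤ (mimw G : ℝ) := by
  refine ⟨1 / 1512, by norm_num, fun N => ?_⟩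
  obtain ⟨j, hj, hjN⟩ : ∃ j, 0 < j ∧ N ≤ j := ⟨N + 1, by omega, by omega⟩
  obtain ⟨f, hf⟩ := exists_disp (9 * j) (by omega)
  have hcard : Fintype.card (W (4 * (9 * j))) = 1512 * j := by
    simp; ring
  let σ : W (4 * (9 * j)) ≃ Fin (1512 * j) := Fintype.equivFinOfCardEq hcard
  refine ⟨1512 * j, (HG f).comap σ.symm, by omega, ?_, ?_, ?_⟩
  · exact (HG_colorable f).of_hom (⟨σ.symm, fun h => h⟩ : (HG f).comap σ.symm →g HG f)
  · exact chord_comap _ _ σ.symm.injective (HG_chord f)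
  · have : j ≤ mimw ((HG f).comap σ.symm) := by
      have : Nonempty (Fin (1512 * j)) := ⟨⟨0, by omega⟩⟩
      apply width_lower
      intro t ht
      obtain ⟨X, hX, h⟩ := big_cut ((HG f).comap σ.symm) j hj f hf
        (fun i => σ (.inl (.inl i))) (fun i => σ (.inl (.inr i)))
        (fun e => σ (.inr (.inl e))) (fun e => σ (.inr (.inr e)))
        (fun i i' h => by simpa using h)
        (fun i e => by simp [HG, rel]) (fun e e' => by simp [HG, rel])
        (fun e e' => by simp [HG, rel]) t ht
      exact ⟨X, hX, le_cutMim _ _ _ h⟩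
    have h' : (j : ℝ) ≤ (mimw ((HG f).comap σ.symm) : ℝ) := by exact_mod_cast this
    push_cast
    linarith

lemma ps_core {V ι : Type*} [Fintype V] [DecidableEq V] [Fintype ι]
    (X : Finset V) (Cs : Finset (Clause V))
    (hmono : ∀ C ∈ Cs, C.2 = ∅) (v : ι → V) (C : ι → Clause V) (hv : ∀ i, v i ∈ X)
    (hC : ∀ i, C i ∈ Cs) (hvC : ∀ i k, v i ∈ (C k).1 ↔ i = k) :
    2 ^ Fintype.card ι ≤ psVal (restrictF X Cs) := by
  rw [← Fintype.card_finset, ← Finset.card_univ]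
  unfold psVal
  let A : Finset ι → V → Bool := fun s x => decide (∃ i ∈ s, v i = x)
  refine Finset.card_le_card_of_injOn
    (fun s => (restrictF X Cs).filter (fun C => csat (A s) C)) ?_ ?_
  · intro s _
    exact Finset.mem_coe.2 (Finset.mem_image.2 ⟨A s, Finset.mem_univ _, by congr⟩)
  · have key : ∀ s i, i ∈ s ↔ ((C i).1 ∩ X, (C i).2 ∩ X) ∈
        (restrictF X Cs).filter (fun C => csat (A s) C) := by
      intro s i
      have hm : ((C i).1 ∩ X, (C i).2 ∩ X) ∈ restrictF X Cs :=
        Finset.mem_image.2 ⟨C i, hC i, rfl⟩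
      rw [Finset.mem_filter, and_iff_right hm]
      have h2 := hmono _ (hC i)
      constructor
      · intro hi
        refine Or.inl ⟨v i, Finset.mem_inter.2 ⟨(hvC i i).2 rfl, hv i⟩, ?_⟩
        simp only [A, decide_eq_true_eq]
        exact ⟨i, hi, rfl⟩
      · rintro (⟨x, hx, hA⟩ | ⟨x, hx, -⟩)
        · simp only [A, decide_eq_true_eq] at hA
          obtain ⟨k, hk, rfl⟩ := hA
          have := (hvC k i).1 (Finset.mem_inter.1 hx).1
          exact this ▸ hk
        · simp [h2] at hx
    intro s _ s' _ hss
    ext i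
    rw [key s, key s']
    simp only at hss
    rw [hss]

/-- The incidence graph of a monotone formula. -/
def inc {V : Type*} (F : Finset (Clause V)) : SimpleGraph (V ⊕ {C // C ∈ F}) where
  Adj x y := match x, y with
    | .inl v, .inr C => v ∈ C.1.1
    | .inr C, .inl v => v ∈ C.1.1
    | _, _ => False
  symm := ⟨fun x y h => by rcases x with x | x <;> rcases y with y | y <;> exact h⟩
  loopless := ⟨fun x h => by rcases x with x | x <;> exact h⟩

lemma ps_cut {V : Type*} [Fintype V] [DecidableEq V] (F : Finset (Clause V))
    (hmono : ∀ C ∈ F, C.2 = ∅) (X : Finset (V ⊕ {C // C ∈ F})) (j : ℕ)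
    (h : CrossIndMatching (inc F) X (2 * j)) : 2 ^ j ≤ psCut F X := by
  obtain ⟨g, hg1, hg2⟩ := h
  have hcls : ∀ Y, ∀ C ∈ clsIn F Y, C.2 = ∅ := by
    intro Y C hC
    unfold clsIn at hC
    obtain ⟨C', -, rfl⟩ := Finset.mem_image.1 hC
    exact hmono _ C'.2
  have hcl : ∀ Y (C : {C // C ∈ F}), Sum.inr C ∈ Y → C.1 ∈ clsIn F Y := by
    intro Y C hC
    exact Finset.mem_image.2 ⟨C, Finset.mem_filter.2 ⟨Finset.mem_attach _ _, hC⟩, rfl⟩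
  have hva : ∀ Y (v : V), Sum.inl v ∈ Y → v ∈ varsIn F Y := by
    intro Y v hv
    exact Finset.mem_filter.2 ⟨Finset.mem_univ _, hv⟩
  have hsplit := Finset.card_filter_add_card_filter_not
    (s := (Finset.univ : Finset (Fin (2 * j)))) (fun i => (g i).1.isLeft = true)
  rw [Finset.card_univ, Fintype.card_fin] at hsplit
  have hL : ∀ i, (g i).1.isLeft = true → ∃ v C, g i = (Sum.inl v, Sum.inr C) := by
    intro i hi
    have := (hg1 i).2.2
    rcases hgi : g i with ⟨x | x, y | y⟩ <;> rw [hgi] at this hi <;> simp [inc] at this hi ⊢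
  have hR : ∀ i, ¬ (g i).1.isLeft = true → ∃ v C, g i = (Sum.inr C, Sum.inl v) := by
    intro i hi
    have := (hg1 i).2.2
    rcases hgi : g i with ⟨x | x, y | y⟩ <;> rw [hgi] at this hi <;> simp [inc] at this hi ⊢
  by_cases hc : j ≤ (Finset.univ.filter (fun i => (g i).1.isLeft = true)).card
  · refine le_trans ?_ (le_max_left _ _)
    choose v C hvC using fun i : {i // (g i).1.isLeft = true} => hL i.1 i.2
    have := ps_core (varsIn F X) (clsIn F Xᶜ) (hcls _) v (fun i => (C i).1)
      (fun i => hva _ _ (by have := (hg1 i.1).1; rwa [hvC] at this))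
      (fun i => hcl _ _ (by have := (hg1 i.1).2.1; rw [hvC] at this; simpa using this))
      (fun i k => by
        constructor
        · intro hm
          by_contra hne
          have := (hg2 i.1 k.1 (fun h => hne (Subtype.ext h))).2.2
          rw [hvC, hvC] at this
          exact this hm
        · rintro rfl
          have := (hg1 i.1).2.2
          rw [hvC] at this
          exact this)
    refine le_trans (Nat.pow_le_pow_right (by norm_num) ?_) this
    rwa [Fintype.card_subtype]
  · refine le_trans ?_ (le_max_right _ _)
    choose v C hvC using fun i : {i // ¬ (g i).1.isLeft = true} => hR i.1 i.2
    have := ps_core (varsIn F Xᶜ) (clsIn F X) (hcls _) v (fun i => (C i).1)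
      (fun i => hva _ _ (by have := (hg1 i.1).2.1; rw [hvC] at this; simpa using this))
      (fun i => hcl _ _ (by have := (hg1 i.1).1; rwa [hvC] at this))
      (fun i k => by
        constructor
        · intro hm
          by_contra hne
          have := (hg2 k.1 i.1 (fun h => hne (Subtype.ext h.symm))).2.2
          rw [hvC, hvC] at this
          exact this hm
        · rintro rfl
          have := (hg1 i.1).2.2
          rw [hvC] at this
          exact this)
    refine le_trans (Nat.pow_le_pow_right (by norm_num) ?_) this
    rw [Fintype.card_subtype]
    omega

lemma elim_suff {V : Type*} [Fintype V] [DecidableEq V] (l : List V) :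
    ∀ (E : Finset (Finset V)), (∀ l1 x l2, l = l1 ++ x :: l2 → ∀ e ∈ E, ∀ f ∈ E, x ∈ e → x ∈ f →
      (∀ y ∈ e, y ∉ l1 → y ∈ f) ∨ (∀ y ∈ f, y ∉ l1 → y ∈ e)) → ElimList l E := by
  induction l with
  | nil => intro E _; trivial
  | cons x xs ih =>
    intro E h
    refine ⟨?_, ih _ ?_⟩
    · intro e he f hf hxe hxf
      rcases h [] x xs rfl e he f hf hxe hxf with h | h
      · exact Or.inl fun y hy => h y hy (by simp)
      · exact Or.inr fun y hy => h y hy (by simp)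
    · intro l1 z l2 hl e he f hf hze hzf
      unfold removeV at he hf
      obtain ⟨e, he', rfl⟩ := Finset.mem_image.1 (Finset.mem_of_mem_erase he)
      obtain ⟨f, hf', rfl⟩ := Finset.mem_image.1 (Finset.mem_of_mem_erase hf)
      rw [Finset.mem_erase] at hze hzf
      rcases h (x :: l1) z l2 (by simp [hl]) e he' f hf' hze.2 hzf.2 with h | h
      · refine Or.inl fun y hy hyl => ?_
        rw [Finset.mem_erase] at hy ⊢
        exact ⟨hy.1, h y hy.2 (by simp [hy.1, hyl])⟩
      · refine Or.inr fun y hy hyl => ?_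
        rw [Finset.mem_erase] at hy ⊢
        exact ⟨hy.1, h y hy.2 (by simp [hy.1, hyl])⟩

section Formula

variable {n : ℕ} {m : ℕ} (f : Ed n → Fin n) (σ : (Fin n ⊕ Ed n) ≃ Fin m)

/-- The two-variable clauses. -/
def clP (e : Ed n) : Clause (Fin m) := ({σ (.inl e.1), σ (.inr e)}, ∅)

/-- The large clauses. -/
noncomputable def clB (v : Fin n) : Clause (Fin m) :=
  (Finset.univ.filter (fun x => ∀ e, σ.symm x = .inr e → f e = v), ∅)

/-- The formula. -/
noncomputable def FF : Finset (Clause (Fin m)) :=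
  Finset.univ.image (clP σ) ∪ Finset.univ.image (clB f σ)

lemma mem_FF (C : Clause (Fin m)) :
    C ∈ FF f σ ↔ (∃ e, C = clP σ e) ∨ (∃ v, C = clB f σ v) := by
  simp [FF, eq_comm]

lemma FF_mono : ∀ C ∈ FF f σ, C.2 = ∅ := by
  intro C hC
  rcases (mem_FF f σ C).1 hC with ⟨e, rfl⟩ | ⟨v, rfl⟩ <;> rfl

lemma aP (i : Fin n) (e : Ed n) : σ (.inl i) ∈ (clP σ e).1 ↔ e.1 = i := by
  simp [clP, eq_comm]

lemma qP (e e' : Ed n) : σ (.inr e') ∈ (clP σ e).1 ↔ e = e' := by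
  simp [clP, eq_comm]

lemma aB (i v : Fin n) : σ (.inl i) ∈ (clB f σ v).1 := by
  simp [clB]

lemma qB (e : Ed n) (v : Fin n) : σ (.inr e) ∈ (clB f σ v).1 ↔ f e = v := by
  simp only [clB, Finset.mem_filter, Finset.mem_univ, true_and, Equiv.symm_apply_apply,
    Sum.inr.injEq]
  exact ⟨fun h => h e rfl, fun h e' he => he ▸ h⟩

lemma FF_vars : fvars (FF f σ) = Finset.univ := by
  ext x
  simp only [Finset.mem_univ, iff_true, fvars, Finset.mem_sup]
  obtain ⟨y, rfl⟩ := σ.surjective x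
  rcases y with i | e
  · exact ⟨clP σ (i, 0), (mem_FF f σ _).2 (Or.inl ⟨_, rfl⟩),
      Finset.mem_union_left _ ((aP σ _ _).2 rfl)⟩
  · exact ⟨clP σ e, (mem_FF f σ _).2 (Or.inl ⟨_, rfl⟩),
      Finset.mem_union_left _ ((qP σ _ _).2 rfl)⟩

lemma FF_beta : BetaAcyclic ((FF f σ).image cvars) := by
  let Lq : List (Fin m) := (Finset.univ : Finset (Ed n)).toList.map (fun e => σ (.inr e))
  let La : List (Fin m) := (Finset.univ : Finset (Fin n)).toList.map (fun e => σ (.inl e))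
  have hq : ∀ e, σ (.inr e) ∈ Lq := fun e => by simp [Lq]
  have ha : ∀ e, σ (.inl e) ∈ La := fun e => by simp [La]
  have hqa : ∀ i, σ (.inl i) ∉ Lq := fun i => by simp [Lq]
  refine ⟨Lq ++ La, ?_, ?_, ?_⟩
  · rw [List.nodup_append']
    refine ⟨(Finset.nodup_toList _).map ?_, (Finset.nodup_toList _).map ?_, ?_⟩
    · intro x y h; simpa using h
    · intro x y h; simpa using h
    · intro x hx hx'
      simp only [La, List.mem_map] at hx'
      obtain ⟨i, -, rfl⟩ := hx'
      exact hqa i hx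
  · intro x
    obtain ⟨y, rfl⟩ := σ.surjective x
    rcases y with i | e
    · exact List.mem_append_right _ (ha i)
    · exact List.mem_append_left _ (hq e)
  · apply elim_suff
    intro l1 x l2 hl e he g hg hxe hxg
    have hform : ∀ e ∈ (FF f σ).image cvars, (∃ k, e = (clP σ k).1) ∨ ∃ v, e = (clB f σ v).1 := by
      intro e he
      obtain ⟨C, hC, rfl⟩ := Finset.mem_image.1 he
      have : cvars C = C.1 := by simp [cvars, FF_mono f σ C hC]
      rw [this]
      rcases (mem_FF f σ C).1 hC with ⟨k, rfl⟩ | ⟨v, rfl⟩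
      · exact Or.inl ⟨k, rfl⟩
      · exact Or.inr ⟨v, rfl⟩
    have hsub : ∀ k : Ed n, (clP σ k).1 ⊆ (clB f σ (f k)).1 := by
      intro k y hy
      simp only [clP, Finset.mem_insert, Finset.mem_singleton] at hy
      rcases hy with rfl | rfl
      · exact aB f σ _ _
      · exact (qB f σ _ _).2 rfl
    obtain ⟨y, rfl⟩ := σ.surjective x
    rcases y with i | k
    · have hl1 : ∀ k, σ (.inr k) ∈ l1 := by
        intro k
        rcases List.append_eq_append_iff.1 hl with ⟨c, h1, h2⟩ | ⟨c, h1, h2⟩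
        · rw [h1]; exact List.mem_append_left _ (hq k)
        · rcases c with _ | ⟨z, c⟩
          · simp at h1
            exact h1 ▸ hq k
          · simp at h2
            exact absurd (by rw [h1, h2.1]; simp) (hqa i)
      have only_a : ∀ y, y ∉ l1 → ∃ i', y = σ (.inl i') := by
        intro y hy
        obtain ⟨z, rfl⟩ := σ.surjective y
        rcases z with z | z
        · exact ⟨z, rfl⟩
        · exact absurd (hl1 z) hy
      rcases hform e he with ⟨k, rfl⟩ | ⟨v, rfl⟩
      · left
        intro y hy hyl
        obtain ⟨i', rfl⟩ := only_a y hyl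
        rw [aP] at hy hxe
        rwa [← hy, hxe]
      · right
        intro y hy hyl
        obtain ⟨i', rfl⟩ := only_a y hyl
        exact aB f σ _ _
    · rcases hform e he with ⟨k1, rfl⟩ | ⟨v1, rfl⟩ <;>
        rcases hform g hg with ⟨k2, rfl⟩ | ⟨v2, rfl⟩
      · rw [qP] at hxe hxg
        subst hxe hxg
        exact Or.inl fun y hy _ => hy
      · rw [qP] at hxe
        rw [qB] at hxg
        subst hxe hxg
        exact Or.inl fun y hy _ => hsub _ hy
      · rw [qB] at hxe
        rw [qP] at hxg
        subst hxe hxg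
        exact Or.inr fun y hy _ => hsub _ hy
      · rw [qB] at hxe hxg
        subst hxe hxg
        exact Or.inl fun y hy _ => hy

end Formula

lemma part_two : ∃ c : ℝ, 0 < c ∧ ∀ N : ℕ, ∃ (n : ℕ) (F : Finset (Clause (Fin n))),
      N ≤ n ∧ (∀ C ∈ F, C.2 = ∅) ∧ fvars F = Finset.univ ∧
      BetaAcyclic (F.image cvars) ∧
      (2 : ℝ) ^ (c * (n : ℝ)) ≤ (psw F : ℝ) := by
  refine ⟨1 / 1512, by norm_num, fun N => ?_⟩
  obtain ⟨j, hj, hjN⟩ : ∃ j, 0 < j ∧ N ≤ j := ⟨N + 1, by omega, by omega⟩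
  obtain ⟨f, hf⟩ := exists_disp (9 * (2 * j)) (by omega)
  have hcard : Fintype.card (Fin (4 * (9 * (2 * j))) ⊕ Ed (4 * (9 * (2 * j)))) = 1512 * j := by
    simp; ring
  let σ : (Fin (4 * (9 * (2 * j))) ⊕ Ed (4 * (9 * (2 * j)))) ≃ Fin (1512 * j) :=
    Fintype.equivFinOfCardEq hcard
  refine ⟨1512 * j, FF f σ, by omega, FF_mono f σ, FF_vars f σ, ?_, ?_⟩
  · convert FF_beta f σ
  · have : 2 ^ j ≤ psw (FF f σ) := by
      have : Nonempty (Fin (1512 * j)) := ⟨⟨0, by omega⟩⟩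
      apply width_lower
      intro t ht
      obtain ⟨X, hX, h⟩ := big_cut (inc (FF f σ)) (2 * j) (by omega) f hf
        (fun i => .inl (σ (.inl i)))
        (fun v => .inr ⟨clB f σ v, (mem_FF f σ _).2 (Or.inr ⟨v, rfl⟩)⟩)
        (fun e => .inr ⟨clP σ e, (mem_FF f σ _).2 (Or.inl ⟨e, rfl⟩)⟩)
        (fun e => .inl (σ (.inr e)))
        (fun i i' h => by simpa using h)
        (fun i e => aP σ i e) (fun e e' => qP σ e e')
        (fun e v => qB f σ e v) t ht
      exact ⟨X, hX, ps_cut _ (FF_mono f σ) X j h⟩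
    have h' : (2 : ℝ) ^ j ≤ (psw (FF f σ) : ℝ) := by exact_mod_cast this
    refine le_trans (le_of_eq ?_) h'
    rw [← Real.rpow_natCast]
    congr 1
    push_cast
    ring

end Stmt17

/-- there is a family of chordal bipartite graphs whose
MIM-width is linear in the number of vertices; consequently there is a family
of monotone β-acyclic CNF-formulas whose PS-width is `2^{Ω(n)}` in the number
`n` of variables. -/
theorem stmt17 :
    (∃ c : ℝ, 0 < c ∧ ∀ N : ℕ, ∃ (m : ℕ) (G : SimpleGraph (Fin m)),
      N ≤ m ∧ G.Colorable 2 ∧ ChordCond G ∧ c * (m : ℝ) ≤ (mimw G : ℝ)) ∧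
    (∃ c : ℝ, 0 < c ∧ ∀ N : ℕ, ∃ (n : ℕ) (F : Finset (Clause (Fin n))),
      N ≤ n ∧ (∀ C ∈ F, C.2 = ∅) ∧ fvars F = Finset.univ ∧
      BetaAcyclic (F.image cvars) ∧
      (2 : ℝ) ^ (c * (n : ℝ)) ≤ (psw F : ℝ)) := by
  exact ⟨Stmt17.part_one, Stmt17.part_two⟩
end
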